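/- arXiv:1803.09233 — 3 statements merged into one kernel-verified Lean document; each statement's English description precedes it below -/
import Mathlib

section
/- Let (R, m, k) be a commutative noetherian local ring and let φ : R → S be a local homomorphism to a commutative noetherian local ring (S, n, ℓ). If S is Tor-persistent and S has finite flat dimension as an R-module, then R is Tor-persistent. -/
open CategoryTheory CategoryTheory.Limits

universe u

/-- An `R`-module `M` has finite projective dimension if it admits a projective
resolution that vanishes in all sufficiently high degrees. -/
def HasFiniteProjDim (R : Type u) [CommRing R] (M : ModuleCat.{u} R) : Prop :=
  ∃ (n : ℕ) (P : CategoryTheory.ProjectiveResolution M),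
    ∀ i, n < i → IsZero (P.complex.X i)

/-- A commutative ring `R` is Tor-persistent if every finitely generated `R`-module `M`
with `Tor_i^R(M, M) = 0` for all sufficiently large `i` has finite projective dimension. -/
def TorPersistent (R : Type u) [CommRing R] : Prop :=
  ∀ M : ModuleCat.{u} R, Module.Finite R M →
    (∃ N : ℕ, ∀ i, N ≤ i → Subsingleton (((Tor (ModuleCat.{u} R) i).obj M).obj M)) →
    HasFiniteProjDim R M

/-- An `R`-module `M` has finite flat dimension (= finite Tor-dimension) if there is a `d`
such that `Tor_i^R(N, M) = 0` for every `R`-module `N` and every `i > d`. -/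
def HasFiniteFlatDim (R : Type u) [CommRing R] (M : ModuleCat.{u} R) : Prop :=
  ∃ d : ℕ, ∀ (N : ModuleCat.{u} R) (i : ℕ), d < i →
    Subsingleton (((Tor (ModuleCat.{u} R) i).obj N).obj M)

open TensorProduct

/-- A sequence of short exact sequences `0 → K (i + 1) → F i → K i → 0`. -/
structure SyzygySeq (R : Type u) [CommRing R] where
  K : ℕ → ModuleCat.{u} R
  F : ℕ → ModuleCat.{u} R
  ι : ∀ i, K (i + 1) →ₗ[R] F i
  π : ∀ i, F i →ₗ[R] K i
  ι_injective : ∀ i, Function.Injective (ι i)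
  exact : ∀ i, Function.Exact (ι i) (π i)
  π_surjective : ∀ i, Function.Surjective (π i)

namespace SyzygySeq

section Shift

variable {R : Type u} [CommRing R] (s t : SyzygySeq R)

/-- `s.F i` and `t.F j` are acyclic for the tensor products with the terms of `t` and `s`. -/
structure Acyclic : Prop where
  left : ∀ i j, Function.Injective ((t.ι j).lTensor (s.F i))
  right : ∀ i j, Function.Injective ((s.ι i).rTensor (t.F j))

variable {s t}

lemma acyclic_of_flat (hs : ∀ i, Module.Flat R (s.F i)) (ht : ∀ i, Module.Flat R (t.F i)) :
    s.Acyclic t where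
  left i j := have := hs i; Module.Flat.lTensor_preserves_injective_linearMap _ (t.ι_injective j)
  right i j := have := ht j; Module.Flat.rTensor_preserves_injective_linearMap _ (s.ι_injective i)

lemma Acyclic.rTensor_iff_lTensor (h : s.Acyclic t) (i j : ℕ) :
    Function.Injective ((s.ι i).rTensor (t.K j)) ↔
      Function.Injective ((t.ι j).lTensor (s.K i)) := by
  constructor
  · intro H
    exact lTensor_injective_of_exact_of_exact_of_rTensor_injective (s.exact i) (s.π_surjective i)
      (t.exact j) (t.π_surjective j) H (h.left i j)
  · intro H
    rw [← LinearMap.lTensor_inj_iff_rTensor_inj]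
    exact lTensor_injective_of_exact_of_exact_of_rTensor_injective (t.exact j) (t.π_surjective j)
      (s.exact i) (s.π_surjective i) ((LinearMap.lTensor_inj_iff_rTensor_inj ..).1 H)
      ((LinearMap.lTensor_inj_iff_rTensor_inj ..).2 (h.right i j))

lemma Acyclic.rTensor_succ_iff (h : s.Acyclic t) (i j : ℕ) :
    Function.Injective ((s.ι (i + 1)).rTensor (t.K j)) ↔
      Function.Injective ((s.ι i).rTensor (t.K (j + 1))) := by
  rw [h.rTensor_iff_lTensor]
  have e : ⇑((s.ι i).rTensor (t.F j)) ∘ ⇑((t.ι j).lTensor (s.K (i + 1))) =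
      ⇑((t.ι j).lTensor (s.F i)) ∘ ⇑((s.ι i).rTensor (t.K (j + 1))) := by
    simp only [← LinearMap.coe_comp, LinearMap.rTensor_comp_lTensor,
      LinearMap.lTensor_comp_rTensor]
  rw [← (h.right i j).of_comp_iff, e, (h.left i j).of_comp_iff]

lemma Acyclic.rTensor_add_iff (h : s.Acyclic t) (i j k : ℕ) :
    Function.Injective ((s.ι (i + k)).rTensor (t.K j)) ↔
      Function.Injective ((s.ι i).rTensor (t.K (j + k))) := by
  induction k generalizing j with
  | zero => rfl
  | succ k ih =>
    rw [← add_assoc, h.rTensor_succ_iff, ih, add_right_comm, add_assoc]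

lemma Acyclic.rTensor_injective (h : s.Acyclic t) {d : ℕ}
    (hd : ∀ j, d ≤ j → Function.Injective ((t.ι j).lTensor (s.K 0))) {i j : ℕ} (hij : d ≤ i + j) :
    Function.Injective ((s.ι i).rTensor (t.K j)) := by
  have := h.rTensor_add_iff 0 j i
  rw [zero_add] at this
  rw [this, h.rTensor_iff_lTensor]
  exact hd _ (by lia)

end Shift

section Constructions

variable {R : Type u} [CommRing R] (s : SyzygySeq R)

/-- Drop the first `n` short exact sequences. -/
def shift (n : ℕ) : SyzygySeq R where
  K i := s.K (n + i)
  F i := s.F (n + i)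
  ι i := s.ι (n + i)
  π i := s.π (n + i)
  ι_injective i := s.ι_injective (n + i)
  exact i := s.exact (n + i)
  π_surjective i := s.π_surjective (n + i)

/-- Tensor a sequence of short exact sequences with a module preserving their exactness. -/
def rTensor (N : Type u) [AddCommGroup N] [Module R N]
    (h : ∀ i, Function.Injective ((s.ι i).rTensor N)) : SyzygySeq R where
  K i := ModuleCat.of R (s.K i ⊗[R] N)
  F i := ModuleCat.of R (s.F i ⊗[R] N)
  ι i := (s.ι i).rTensor N
  π i := (s.π i).rTensor N
  ι_injective := h
  exact i := rTensor_exact N (s.exact i) (s.π_surjective i)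
  π_surjective i := LinearMap.rTensor_surjective N (s.π_surjective i)

/-- Base change of a sequence of short exact sequences along an algebra preserving their
exactness. -/
def baseChange (S : Type u) [CommRing S] [Algebra R S]
    (h : ∀ i, Function.Injective ((s.ι i).lTensor S)) : SyzygySeq S where
  K i := ModuleCat.of S (S ⊗[R] s.K i)
  F i := ModuleCat.of S (S ⊗[R] s.F i)
  ι i := (s.ι i).baseChange S
  π i := (s.π i).baseChange S
  ι_injective := h
  exact i := lTensor_exact S (s.exact i) (s.π_surjective i)
  π_surjective i := LinearMap.lTensor_surjective S (s.π_surjective i)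

/-- The maps `X ⊗[S] (S ⊗[R] K (i + 1)) → X ⊗[S] (S ⊗[R] F i)` and
`X ⊗[R] K (i + 1) → X ⊗[R] F i` are simultaneously injective. -/
lemma lTensor_baseChange_injective_iff {S X A B : Type u} [CommRing S] [Algebra R S]
    [AddCommGroup X] [Module R X] [Module S X] [IsScalarTower R S X]
    [AddCommGroup A] [Module R A] [AddCommGroup B] [Module R B] (f : A →ₗ[R] B) :
    Function.Injective ((f.baseChange S).lTensor X) ↔ Function.Injective (f.lTensor X) := by
  let eA := AlgebraTensorModule.cancelBaseChange R S S X A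
  let eB := AlgebraTensorModule.cancelBaseChange R S S X B
  have e : ⇑(f.lTensor X) ∘ ⇑eA = ⇑eB ∘ ⇑((f.baseChange S).lTensor X) :=
    congrArg DFunLike.coe (AlgebraTensorModule.lTensor_comp_cancelBaseChange R S S f)
  rw [← eB.injective.of_comp_iff, ← e, Function.Injective.of_comp_iff' _ eA.bijective]

end Constructions

section Tor

variable {R : Type u} [CommRing R] (s : SyzygySeq R)

/-- The composition `F (i + 1) → K (i + 1) → F i`. -/
noncomputable def d (i : ℕ) : s.F (i + 1) ⟶ s.F i :=
  ModuleCat.ofHom (s.ι i ∘ₗ s.π (i + 1))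

lemma d_comp_d (i : ℕ) : s.d (i + 1) ≫ s.d i = 0 := by
  ext x
  simp [d, (s.exact (i + 1)).apply_apply_eq_zero]

lemma d_zero_comp_π : s.d 0 ≫ (ModuleCat.ofHom (s.π 0) : s.F 0 ⟶ s.K 0) = 0 := by
  ext x
  simp [d, (s.exact 0).apply_apply_eq_zero]

/-- The chain complex `⋯ → F 2 → F 1 → F 0`. -/
noncomputable def complex : ChainComplex (ModuleCat.{u} R) ℕ :=
  ChainComplex.of s.F s.d s.d_comp_d

lemma complex_d (i : ℕ) : s.complex.d (i + 1) i = s.d i :=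
  ChainComplex.of_d s.F s.d i

lemma lTensor_exact_iff (X : Type u) [AddCommGroup X] [Module R X] (i : ℕ) :
    Function.Exact ((s.ι (i + 1) ∘ₗ s.π (i + 2)).lTensor X) ((s.ι i ∘ₗ s.π (i + 1)).lTensor X) ↔
      Function.Injective ((s.ι i).lTensor X) := by
  have hsurj := LinearMap.lTensor_surjective X (s.π_surjective (i + 1))
  have hex := lTensor_exact X (s.exact (i + 1)) (s.π_surjective (i + 1))
  rw [LinearMap.lTensor_comp, LinearMap.lTensor_comp,
    (LinearMap.lTensor_surjective X (s.π_surjective (i + 2))).comp_exact_iff_exact]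
  constructor
  · intro h
    rw [injective_iff_map_eq_zero]
    intro y hy
    obtain ⟨x, rfl⟩ := hsurj y
    exact (hex x).2 ((h x).1 hy)
  · intro h
    exact (Function.Injective.comp_exact_iff_exact h).2 hex

/-- The short complexes of `s.complex` are the evident ones. -/
noncomputable def complexShortComplexIso (i : ℕ) : s.complex.sc' (i + 2) (i + 1) i ≅
    ShortComplex.mk (s.d (i + 1)) (s.d i) (s.d_comp_d i) :=
  ShortComplex.isoMk (Iso.refl (s.F (i + 2))) (Iso.refl (s.F (i + 1))) (Iso.refl (s.F i))
    ((Category.id_comp _).trans ((s.complex_d (i + 1)).symm.trans (Category.comp_id _).symm))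
    ((Category.id_comp _).trans ((s.complex_d i).symm.trans (Category.comp_id _).symm))

lemma exactAt_mapHomologicalComplex_iff {D : Type*} [Category* D] [Abelian D]
    (G : ModuleCat.{u} R ⥤ D) [G.Additive] (i : ℕ) :
    ((G.mapHomologicalComplex _).obj s.complex).ExactAt (i + 1) ↔
      ((ShortComplex.mk (s.d (i + 1)) (s.d i) (s.d_comp_d i)).map G).Exact := by
  rw [HomologicalComplex.exactAt_iff' _ (i + 2) (i + 1) i (by simp) (by simp)]
  exact ShortComplex.exact_iff_of_iso (G.mapShortComplex.mapIso (s.complexShortComplexIso i))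

lemma complex_exactAt (i : ℕ) : s.complex.ExactAt (i + 1) := by
  rw [HomologicalComplex.exactAt_iff' _ (i + 2) (i + 1) i (by simp) (by simp),
    ShortComplex.exact_iff_of_iso (s.complexShortComplexIso i),
    ShortComplex.ShortExact.moduleCat_exact_iff_function_exact]
  exact ((s.π_surjective (i + 2)).comp_exact_iff_exact).2
    ((s.ι_injective i).comp_exact_iff_exact.2 (s.exact (i + 1)))

/-- The augmentation of the complex of syzygies. -/
noncomputable def augmentation : s.complex ⟶ (ChainComplex.single₀ (ModuleCat.{u} R)).obj (s.K 0) :=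
  (ChainComplex.toSingle₀Equiv _ _).symm ⟨(ModuleCat.ofHom (s.π 0) : s.F 0 ⟶ s.K 0), by
    rw [complex_d]
    exact s.d_zero_comp_π⟩

lemma augmentation_f_zero : s.augmentation.f 0 = (ModuleCat.ofHom (s.π 0) : s.F 0 ⟶ s.K 0) :=
  ChainComplex.toSingle₀Equiv_symm_apply_f_zero _ _

lemma quasiIso_augmentation : QuasiIso s.augmentation where
  quasiIsoAt n := by
    cases n with
    | zero =>
      rw [ChainComplex.quasiIsoAt₀_iff, ShortComplex.quasiIso_iff_of_zeros' _ rfl rfl rfl]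
      refine (ShortComplex.exact_and_epi_g_iff_of_iso (S₂ := ShortComplex.mk
          (s.d 0) (ModuleCat.ofHom (s.π 0) : s.F 0 ⟶ s.K 0) s.d_zero_comp_π)
          (ShortComplex.isoMk (Iso.refl (s.F 1)) (Iso.refl (s.F 0)) (Iso.refl (s.K 0))
          ((Category.id_comp _).trans ((s.complex_d 0).symm.trans (Category.comp_id _).symm))
          ((Category.id_comp _).trans (s.augmentation_f_zero.symm.trans (Category.comp_id _).symm))
          )).2 ⟨?_, ?_⟩
      · rw [ShortComplex.ShortExact.moduleCat_exact_iff_function_exact]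
        exact ((s.π_surjective 1).comp_exact_iff_exact).2 (s.exact 0)
      · exact (ModuleCat.epi_iff_surjective _).2 (s.π_surjective 0)
    | succ n =>
      rw [quasiIsoAt_iff_exactAt']
      · apply complex_exactAt
      · apply ChainComplex.exactAt_succ_single_obj

/-- The projective resolution of `K 0` given by a sequence of syzygies. -/
noncomputable def projectiveResolution (h : ∀ i, Module.Projective R (s.F i)) :
    ProjectiveResolution (s.K 0) where
  complex := s.complex
  projective i := (IsProjective.iff_projective (R := R) (s.F i)).1 (h i)
  π := s.augmentation
  quasiIso := s.quasiIso_augmentation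

lemma subsingleton_Tor_iff (h : ∀ i, Module.Projective R (s.F i)) (X : ModuleCat.{u} R) (i : ℕ) :
    Subsingleton (((Tor (ModuleCat.{u} R) (i + 1)).obj X).obj (s.K 0)) ↔
      Function.Injective ((s.ι i).lTensor X) := by
  rw [← lTensor_exact_iff, ← ModuleCat.isZero_iff_subsingleton, Tor_obj,
    ((s.projectiveResolution h).isoLeftDerivedObj _ (i + 1)).isZero_iff]
  refine (HomologicalComplex.exactAt_iff_isZero_homology ..).symm.trans ?_
  refine (s.exactAt_mapHomologicalComplex_iff _ i).trans ?_
  rw [ShortComplex.ShortExact.moduleCat_exact_iff_function_exact]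
  rfl

end Tor

end SyzygySeq

lemma HasFiniteProjDim.hasFiniteFlatDim {R : Type u} [CommRing R] {M : ModuleCat.{u} R}
    (h : HasFiniteProjDim R M) : HasFiniteFlatDim R M := by
  obtain ⟨n, P, hP⟩ := h
  refine ⟨n, fun N i hi ↦ ?_⟩
  rw [← ModuleCat.isZero_iff_subsingleton, Tor_obj, (P.isoLeftDerivedObj _ i).isZero_iff]
  refine (HomologicalComplex.exactAt_iff_isZero_homology ..).1 ?_
  exact ShortComplex.exact_of_isZero_X₂ _
    (((MonoidalCategory.tensoringLeft (ModuleCat.{u} R)).obj N).map_isZero (hP i hi))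

/-- Every module is a quotient of a projective module, where the projective module is chosen as
small as the module allows. -/
lemma exists_projective_presentation (R : Type u) [CommRing R] (M : ModuleCat.{u} R) :
    ∃ (K F : ModuleCat.{u} R) (ι : K →ₗ[R] F) (π : F →ₗ[R] M),
      Function.Injective ι ∧ Function.Exact ι π ∧ Function.Surjective π ∧
      Module.Projective R F ∧ (Module.Finite R M → Module.Finite R F) ∧
      (Module.Projective R M → Subsingleton K) ∧ (Subsingleton M → Subsingleton F) := by
  by_cases hM : Module.Projective R M
  · refine ⟨ModuleCat.of R PUnit, M, 0, LinearMap.id, Function.injective_of_subsingleton _, ?_,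
      Function.surjective_id, hM, id, fun _ ↦ inferInstanceAs (Subsingleton PUnit), id⟩
    exact (LinearMap.exact_zero_iff_injective _ _).2 Function.injective_id
  · have hM' : ¬ Subsingleton M := fun _ ↦ hM inferInstance
    by_cases hfin : Module.Finite R M
    · obtain ⟨n, f, hf⟩ := Module.Finite.exists_fin' R M
      exact ⟨ModuleCat.of R (LinearMap.ker f), ModuleCat.of R (Fin n → R),
        (LinearMap.ker f).subtype, f, Subtype.val_injective, LinearMap.exact_subtype_ker_map f, hf,
        inferInstanceAs (Module.Projective R (Fin n → R)),
        fun _ ↦ inferInstanceAs (Module.Finite R (Fin n → R)), fun h ↦ (hM h).elim,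
        fun h ↦ (hM' h).elim⟩
    · let f := Finsupp.linearCombination R (id : M → M)
      exact ⟨ModuleCat.of R (LinearMap.ker f), ModuleCat.of R (M →₀ R), (LinearMap.ker f).subtype,
        f, Subtype.val_injective, LinearMap.exact_subtype_ker_map f,
        Finsupp.linearCombination_id_surjective R M,
        inferInstanceAs (Module.Projective R (M →₀ R)),
        fun h ↦ (hfin h).elim, fun h ↦ (hM h).elim,
        fun h ↦ (hM' h).elim⟩

namespace SyzygySeq

/-- Every module has a sequence of syzygies which stops at the first projective syzygy. -/
lemma exists_projective {R : Type u} [CommRing R] (M : ModuleCat.{u} R) :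
    ∃ s : SyzygySeq R, s.K 0 = M ∧ (∀ i, Module.Projective R (s.F i)) ∧
      (∀ i, Module.Finite R (s.K i) → Module.Finite R (s.F i)) ∧
      (∀ i, Module.Projective R (s.K i) → Subsingleton (s.F (i + 1))) := by
  choose K F ι π hι hex hπ hF hfin hproj hsub using exists_projective_presentation R
  let syz (i : ℕ) : ModuleCat.{u} R := Nat.rec M (fun _ N ↦ K N) i
  exact ⟨{ K := syz
           F i := F (syz i)
           ι i := ι (syz i)
           π i := π (syz i)
           ι_injective i := hι (syz i)
           exact i := hex (syz i)
           π_surjective i := hπ (syz i) }, rfl, fun i ↦ hF (syz i), fun i ↦ hfin (syz i),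
    fun i h ↦ hsub (syz (i + 1)) (hproj (syz i) h)⟩

/-- Finitely generated covers of finitely generated syzygies have finitely generated syzygies. -/
lemma finite_K {R : Type u} [CommRing R] [IsNoetherianRing R] (s : SyzygySeq R)
    (h₀ : Module.Finite R (s.K 0))
    (h : ∀ i, Module.Finite R (s.K i) → Module.Finite R (s.F i)) (i : ℕ) :
    Module.Finite R (s.K i) := by
  induction i with
  | zero => exact h₀
  | succ i ih =>
    have := h i ih
    exact Module.Finite.of_injective (s.ι i) (s.ι_injective i)

lemma lTensor_tensor_injective {R A B P Q : Type u} [CommRing R] [AddCommGroup A] [Module R A]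
    [AddCommGroup B] [Module R B] [AddCommGroup P] [Module R P] [AddCommGroup Q] [Module R Q]
    {f : A →ₗ[R] B} (h : Function.Injective ((f.lTensor Q).lTensor P)) :
    Function.Injective (f.lTensor (P ⊗[R] Q)) := by
  rw [LinearMap.lTensor_tensor]
  simpa using h

lemma lTensor_residueField_injective {R S : Type u} [CommRing R] [IsLocalRing R] [CommRing S]
    [IsLocalRing S] [Algebra R S] [IsLocalHom (algebraMap R S)]
    {A B : Type u} [AddCommGroup A] [Module R A] [AddCommGroup B] [Module R B] {f : A →ₗ[R] B}
    (h : Function.Injective (f.lTensor (IsLocalRing.ResidueField S))) :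
    Function.Injective (f.lTensor (IsLocalRing.ResidueField R)) := by
  rw [← lTensor_baseChange_injective_iff (S := IsLocalRing.ResidueField R)] at h
  exact (Module.FaithfullyFlat.lTensor_injective_iff_injective (IsLocalRing.ResidueField R)
    (IsLocalRing.ResidueField S) (f.baseChange (IsLocalRing.ResidueField R))).1 h

/-- If `K n` has vanishing higher Tor with itself and with `t.K 0`, where `t.K 0` has flat
dimension at most `d`, then `Tor_i (K n, K n ⊗ t.K 0)` vanishes for `i > d`. -/
lemma rTensor_rTensor_injective {R : Type u} [CommRing R] {s t : SyzygySeq R} {n d : ℕ}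
    (hs : ∀ i, Module.Flat R (s.F i)) (ht : ∀ i, Module.Flat R (t.F i))
    (hn : ∀ i j, n ≤ i + j → Function.Injective ((s.ι i).rTensor (s.K j)))
    (hnt : ∀ i j, n ≤ i + j → Function.Injective ((s.ι i).rTensor (t.K j)))
    (hd : ∀ (X : ModuleCat.{u} R) (j : ℕ), d ≤ j → Function.Injective ((t.ι j).lTensor X))
    {i : ℕ} (hi : d ≤ i) :
    Function.Injective (((s.ι (n + i)).rTensor (s.K n)).rTensor (t.K 0)) := by
  let s' := (s.shift n).rTensor (s.K n) fun i ↦ hn (n + i) n (by lia)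
  have hst : s.Acyclic t := acyclic_of_flat hs ht
  have h : s'.Acyclic t :=
    { left i j := by
        have : Module.Flat R ((s.shift n).F i) := hs (n + i)
        exact lTensor_tensor_injective (Module.Flat.lTensor_preserves_injective_linearMap _
          ((hst.rTensor_iff_lTensor n j).1 (hnt n j (by lia))))
      right i j := by
        have := ht j
        exact Module.Flat.rTensor_preserves_injective_linearMap _ (s'.ι_injective i) }
  exact h.rTensor_injective (fun j ↦ hd _ j) (i := i) (j := 0) (by lia)

end SyzygySeq

lemma HasFiniteFlatDim.exists_syzygySeq {R : Type u} [CommRing R] {N : ModuleCat.{u} R}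
    (h : HasFiniteFlatDim R N) :
    ∃ t : SyzygySeq R, t.K 0 = N ∧ (∀ i, Module.Flat R (t.F i)) ∧ ∃ d : ℕ,
      ∀ (X : ModuleCat.{u} R) (j : ℕ), d ≤ j → Function.Injective ((t.ι j).lTensor X) := by
  obtain ⟨d, hd⟩ := h
  obtain ⟨t, rfl, hF, -⟩ := SyzygySeq.exists_projective N
  exact ⟨t, rfl, fun i ↦ have := hF i; inferInstance, d,
    fun X j hj ↦ (t.subsingleton_Tor_iff hF X j).1 (hd X (j + 1) (by lia))⟩

/-- If `(R,𝔪) → (S,𝔫)` is a local homomorphism of commutative noetherian local rings,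
`S` is Tor-persistent and `S` has finite flat dimension over `R`, then `R` is
Tor-persistent. -/
theorem torPersistent_of_localHom_finite_flat_dim
    {R S : Type u} [CommRing R] [IsNoetherianRing R] [IsLocalRing R]
    [CommRing S] [IsNoetherianRing S] [IsLocalRing S]
    (φ : R →+* S) (hloc : IsLocalHom φ) (hTP : TorPersistent S)
    (hfd : letI := φ.toAlgebra; HasFiniteFlatDim R (ModuleCat.of R S)) :
    TorPersistent R := by
  algebraize [φ]
  have : IsLocalHom (algebraMap R S) := hloc
  intro M hM ⟨N, hN⟩
  obtain ⟨s, rfl, hproj, hfin, hsub⟩ := SyzygySeq.exists_projective M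
  obtain ⟨t, ht₀, ht, d, hd⟩ := hfd.exists_syzygySeq
  have hs (i) : Module.Flat R (s.F i) := have := hproj i; inferInstance
  have hK (i) : Module.Finite R (s.K i) := s.finite_K hM hfin i
  have hss {i j : ℕ} (hij : N ≤ i + j) : Function.Injective ((s.ι i).rTensor (s.K j)) :=
    (SyzygySeq.acyclic_of_flat hs hs).rTensor_injective
      (fun j hj ↦ (s.subsingleton_Tor_iff hproj _ j).1 (hN (j + 1) (by lia))) hij
  have hst {i j : ℕ} (hij : d ≤ i + j) : Function.Injective ((s.ι i).rTensor (t.K j)) :=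
    (SyzygySeq.acyclic_of_flat hs ht).rTensor_injective (fun j ↦ hd _ j) hij
  obtain ⟨n, hNn, hdn⟩ : ∃ n, N ≤ n ∧ d ≤ n := ⟨max N d, le_max_left .., le_max_right ..⟩
  have hS (i) : Function.Injective ((s.ι (n + i)).lTensor S) := by
    have := hst (i := n + i) (j := 0) (by lia)
    rw [ht₀] at this
    exact (LinearMap.lTensor_inj_iff_rTensor_inj ..).2 this
  have hSK (i) (hi : d ≤ i) : Function.Injective ((s.ι (n + i)).lTensor (S ⊗[R] s.K n)) := by
    have := SyzygySeq.rTensor_rTensor_injective hs ht (n := n) (fun i j hij ↦ hss (hNn.trans hij))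
      (fun i j hij ↦ hst (hdn.trans hij)) hd hi
    rw [ht₀] at this
    apply SyzygySeq.lTensor_tensor_injective
    rw [← LinearMap.comm_comp_rTensor_comp_comm_eq (s.ι (n + i)), LinearMap.lTensor_comp,
      LinearMap.lTensor_comp]
    exact ((TensorProduct.comm R _ _).lTensor S).injective.comp
      (((LinearMap.lTensor_inj_iff_rTensor_inj ..).2 this).comp
        ((TensorProduct.comm R _ _).lTensor S).injective)
  let sS := (s.shift n).baseChange S hS
  have hprojS (i) : Module.Projective S (sS.F i) :=
    have := hproj (n + i)
    inferInstanceAs (Module.Projective S (S ⊗[R] s.F (n + i)))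
  have hfinS : Module.Finite S (sS.K 0) := inferInstanceAs (Module.Finite S (S ⊗[R] s.K n))
  obtain ⟨m, hm⟩ := (hTP (sS.K 0) hfinS ⟨d + 1, fun i hi ↦ by
    obtain ⟨i, rfl⟩ := Nat.exists_eq_add_of_le' (Nat.one_le_of_lt hi)
    rw [sS.subsingleton_Tor_iff hprojS]
    exact (SyzygySeq.lTensor_baseChange_injective_iff (S := S) (X := S ⊗[R] s.K n)
      (s.ι (n + i))).2 (hSK i (by lia))⟩).hasFiniteFlatDim
  have hfree (i) (hi : m ≤ i) : Module.Free R (s.K (n + i)) := by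
    have := (sS.subsingleton_Tor_iff hprojS (ModuleCat.of S (IsLocalRing.ResidueField S)) i).1
      (hm _ _ (by lia))
    have hk := SyzygySeq.lTensor_residueField_injective
      ((SyzygySeq.lTensor_baseChange_injective_iff (s.ι (n + i))).1 this)
    have := hfin _ (hK (n + i))
    have := hs (n + i)
    have : Module.Free R (s.F (n + i)) := Module.free_of_flat_of_isLocalRing
    exact Module.free_of_lTensor_residueField_injective _ _ (s.π_surjective _) (s.exact _) hk
  refine ⟨n + m, s.projectiveResolution hproj, fun i hi ↦ ?_⟩
  obtain ⟨j, rfl⟩ := Nat.exists_eq_add_of_lt hi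
  have := hfree (m + j) (by lia)
  rw [← add_assoc] at this
  have := hsub (n + m + j) inferInstance
  exact ModuleCat.isZero_of_subsingleton (s.F (n + m + j + 1))
end

section
/- Let (R, m, k) be a commutative noetherian local ring and let x_1, …, x_n be an R-regular sequence. If the quotient ring R/(x_1, …, x_n) is Tor-persistent, then R is Tor-persistent. -/
open CategoryTheory CategoryTheory.Limits

universe u

namespace CategoryTheory.ProjectiveResolution

section Splice

variable {C : Type*} [Category* C] [Abelian C]

/-- The augmentation of a projective resolution. -/
noncomputable def augmentation {X : C} (P : ProjectiveResolution X) : P.complex.X 0 ⟶ X :=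
  P.π.f 0

lemma d_comp_augmentation {X : C} (P : ProjectiveResolution X) :
    P.complex.d 1 0 ≫ P.augmentation = 0 :=
  P.complex_d_comp_π_f_zero

instance {X : C} (P : ProjectiveResolution X) : Epi P.augmentation :=
  inferInstanceAs (Epi (P.π.f 0))

lemma exact_augmentation {X : C} (P : ProjectiveResolution X) :
    (ShortComplex.mk _ _ P.d_comp_augmentation).Exact :=
  P.exact₀

variable {S : ShortComplex C} (Q : ProjectiveResolution S.X₁)

/-- The complex obtained by splicing a projective resolution of `S.X₁` with `S.X₂ ⟶ S.X₃`. -/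
noncomputable def spliceComplex : ChainComplex C ℕ :=
  Q.complex.augment (Q.augmentation ≫ S.f)
    (by rw [← Category.assoc, d_comp_augmentation, zero_comp])

lemma augmentation_comp_f_comp_g : (Q.augmentation ≫ S.f) ≫ S.g = 0 := by
  rw [Category.assoc, S.zero, comp_zero]

lemma spliceComplex_exactAt_succ (hS : S.ShortExact) (n : ℕ) : Q.spliceComplex.ExactAt (n + 1) := by
  rw [HomologicalComplex.exactAt_iff' _ (n + 2) (n + 1) n (by simp) (by simp)]
  have := hS.mono_f
  cases n with
  | zero =>
    let φ : ShortComplex.mk _ _ Q.d_comp_augmentation ⟶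
        ShortComplex.mk (Q.complex.d 1 0) (Q.augmentation ≫ S.f)
          (by rw [← Category.assoc, d_comp_augmentation, zero_comp]) :=
      { τ₁ := 𝟙 _, τ₂ := 𝟙 _, τ₃ := S.f }
    exact (ShortComplex.exact_iff_of_epi_of_isIso_of_mono φ).1 Q.exact_augmentation
  | succ n => exact Q.exact_succ n

lemma exact_augmentation_comp_f (hS : S.ShortExact) :
    (ShortComplex.mk _ _ Q.augmentation_comp_f_comp_g).Exact := by
  let φ : ShortComplex.mk _ _ Q.augmentation_comp_f_comp_g ⟶ S :=
    { τ₁ := Q.augmentation, τ₂ := 𝟙 _, τ₃ := 𝟙 _ }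
  exact (ShortComplex.exact_iff_of_epi_of_isIso_of_mono φ).2 hS.exact

/-- A projective resolution of `S.X₁`, spliced with a short exact sequence `S` whose middle term
is projective, gives a projective resolution of `S.X₃`. -/
noncomputable def splice (hS : S.ShortExact) [Projective S.X₂] : ProjectiveResolution S.X₃ where
  complex := Q.spliceComplex
  projective n := by
    cases n with
    | zero => assumption
    | succ n => exact Q.projective n
  π := (ChainComplex.toSingle₀Equiv _ _).symm ⟨S.g, Q.augmentation_comp_f_comp_g⟩
  quasiIso := ⟨fun n => by
    have := hS.epi_g
    cases n with
    | zero =>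
      rw [ChainComplex.quasiIsoAt₀_iff, ShortComplex.quasiIso_iff_of_zeros' _ (by rfl) (by rfl)
        (by rfl)]
      have hπ := ChainComplex.toSingle₀Equiv_symm_apply_f_zero (C := Q.spliceComplex) S.g
        (Q.augmentation_comp_f_comp_g)
      refine ⟨?_, ?_⟩
      · suffices ∀ (g : S.X₂ ⟶ S.X₃) (w : (Q.augmentation ≫ S.f) ≫ g = 0), g = S.g →
          (ShortComplex.mk _ _ w).Exact from this _ _ hπ
        rintro _ _ rfl
        exact Q.exact_augmentation_comp_f hS
      · suffices ∀ g : S.X₂ ⟶ S.X₃, g = S.g → Epi g from this _ hπ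
        rintro _ rfl
        assumption
    | succ n =>
      rw [quasiIsoAt_iff_exactAt' _ _ (ChainComplex.exactAt_succ_single_obj _ _)]
      exact Q.spliceComplex_exactAt_succ hS n⟩

end Splice

end CategoryTheory.ProjectiveResolution

open TensorProduct

section Tor

variable (R : Type u) [CommRing R]

/-- `TorVanishes R i A B` means `Tor_i^R(A, B) = 0`. -/
def TorVanishes (i : ℕ) (A B : Type u) [AddCommGroup A] [Module R A] [AddCommGroup B]
    [Module R B] : Prop :=
  Subsingleton (((Tor (ModuleCat.{u} R) i).obj (ModuleCat.of R A)).obj (ModuleCat.of R B))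

variable {R}

open MonoidalCategory in
lemma subsingleton_tor_iff_exact {A B : ModuleCat.{u} R} (P : ProjectiveResolution B) (n : ℕ) :
    Subsingleton (((Tor (ModuleCat.{u} R) (n + 1)).obj A).obj B) ↔
      Function.Exact ((P.complex.d (n + 2) (n + 1)).hom.lTensor A)
        ((P.complex.d (n + 1) n).hom.lTensor A) := by
  rw [← ModuleCat.isZero_iff_subsingleton]
  refine (P.isoLeftDerivedObj ((tensoringLeft (ModuleCat.{u} R)).obj A) (n + 1)).isZero_iff.trans ?_
  refine (HomologicalComplex.exactAt_iff_isZero_homology _ _).symm.trans ?_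
  rw [HomologicalComplex.exactAt_iff' _ (n + 2) (n + 1) n (by simp) (by simp),
    ShortComplex.ShortExact.moduleCat_exact_iff_function_exact]
  rfl

variable {A : Type u} [AddCommGroup A] [Module R A]
  {K P B : Type u} [AddCommGroup K] [Module R K] [AddCommGroup P] [Module R P] [AddCommGroup B]
  [Module R B] {f : K →ₗ[R] P} {g : P →ₗ[R] B}

lemma shortExact_of_linearMap (hf : Function.Injective f) (hfg : Function.Exact f g)
    (hg : Function.Surjective g) :
    (ShortComplex.mk (ModuleCat.ofHom f) (ModuleCat.ofHom g)
      (ModuleCat.hom_ext hfg.linearMap_comp_eq_zero)).ShortExact where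
  exact := (ShortComplex.ShortExact.moduleCat_exact_iff_function_exact _).2 hfg
  mono_f := (ModuleCat.mono_iff_injective _).2 hf
  epi_g := (ModuleCat.epi_iff_surjective _).2 hg

/-- The spliced resolution attached to a short exact sequence of modules. -/
noncomputable def spliceOfLinearMap [Module.Projective R P] (hf : Function.Injective f)
    (hfg : Function.Exact f g) (hg : Function.Surjective g)
    (Q : ProjectiveResolution (ModuleCat.of R K)) : ProjectiveResolution (ModuleCat.of R B) :=
  have : Projective (ModuleCat.of R P) := (IsProjective.iff_projective _).1 ‹_›
  ProjectiveResolution.splice (S := ShortComplex.mk (ModuleCat.ofHom f) (ModuleCat.ofHom g)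
    (ModuleCat.hom_ext hfg.linearMap_comp_eq_zero)) Q (shortExact_of_linearMap hf hfg hg)

lemma torVanishes_add_two_iff [Module.Projective R P] (hf : Function.Injective f)
    (hfg : Function.Exact f g) (hg : Function.Surjective g) (n : ℕ) :
    TorVanishes R (n + 2) A B ↔ TorVanishes R (n + 1) A K := by
  let Q := projectiveResolution (ModuleCat.of R K)
  exact (subsingleton_tor_iff_exact (A := ModuleCat.of R A) (spliceOfLinearMap hf hfg hg Q)
    (n + 1)).trans (subsingleton_tor_iff_exact Q n).symm

lemma torVanishes_one_iff [Module.Projective R P] (hf : Function.Injective f)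
    (hfg : Function.Exact f g) (hg : Function.Surjective g) :
    TorVanishes R 1 A B ↔ Function.Injective (f.lTensor A) := by
  let Q := projectiveResolution (ModuleCat.of R K)
  have h₁ := subsingleton_tor_iff_exact (A := ModuleCat.of R A) (spliceOfLinearMap hf hfg hg Q) 0
  refine h₁.trans ?_
  change Function.Exact ((Q.complex.d 1 0).hom.lTensor A)
    ((f ∘ₗ Q.augmentation.hom).lTensor A) ↔ _
  have hs : Function.Surjective Q.augmentation.hom :=
    (ModuleCat.epi_iff_surjective _).1 inferInstance
  have he : Function.Exact (Q.complex.d 1 0).hom Q.augmentation.hom :=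
    (ShortComplex.ShortExact.moduleCat_exact_iff_function_exact _).1 Q.exact_augmentation
  have he' := lTensor_exact A he hs
  have hs' := LinearMap.lTensor_surjective A hs
  rw [LinearMap.lTensor_comp]
  refine ⟨fun h => ?_, fun h => ?_⟩
  · rw [injective_iff_map_eq_zero]
    intro x hx
    obtain ⟨y, rfl⟩ := hs' x
    exact (he' y).2 ((h y).1 hx)
  · exact he'.comp_injective _ h (map_zero _)

variable (R B) in
/-- The canonical free module surjecting onto `B`. -/
def FreeCover : Type u := B →₀ R

noncomputable instance : AddCommGroup (FreeCover R B) := inferInstanceAs (AddCommGroup (B →₀ R))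

noncomputable instance : Module R (FreeCover R B) := inferInstanceAs (Module R (B →₀ R))

instance : Module.Free R (FreeCover R B) := inferInstanceAs (Module.Free R (B →₀ R))

variable (R B) in
/-- The canonical free cover of a module. -/
noncomputable def freeCover : FreeCover R B →ₗ[R] B :=
  Finsupp.linearCombination R id

variable (R B) in
/-- The kernel of the canonical free cover. -/
def Syzygy : Type u := LinearMap.ker (freeCover R B)

noncomputable instance : AddCommGroup (Syzygy R B) :=
  inferInstanceAs (AddCommGroup (LinearMap.ker (freeCover R B)))

noncomputable instance : Module R (Syzygy R B) :=
  inferInstanceAs (Module R (LinearMap.ker (freeCover R B)))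

variable (R B) in
/-- The inclusion of the kernel of the canonical free cover. -/
noncomputable def syzygyInclusion : Syzygy R B →ₗ[R] FreeCover R B :=
  (LinearMap.ker (freeCover R B)).subtype

variable (R B) in
lemma freeCover_surjective : Function.Surjective (freeCover R B) :=
  Finsupp.linearCombination_id_surjective R B

variable (R B) in
lemma syzygyInclusion_injective : Function.Injective (syzygyInclusion R B) :=
  Submodule.subtype_injective _

variable (R B) in
lemma exact_syzygyInclusion_freeCover :
    Function.Exact (syzygyInclusion R B) (freeCover R B) :=
  LinearMap.exact_subtype_ker_map _

lemma torVanishes_add_two_iff_syzygy (n : ℕ) :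
    TorVanishes R (n + 2) A B ↔ TorVanishes R (n + 1) A (Syzygy R B) :=
  torVanishes_add_two_iff (syzygyInclusion_injective R B) (exact_syzygyInclusion_freeCover R B)
    (freeCover_surjective R B) n

lemma torVanishes_one_iff_syzygy :
    TorVanishes R 1 A B ↔ Function.Injective ((syzygyInclusion R B).lTensor A) :=
  torVanishes_one_iff (syzygyInclusion_injective R B) (exact_syzygyInclusion_freeCover R B)
    (freeCover_surjective R B)

/-- In the square `X₁ ⊗ Y₁ → X₂ ⊗ Y₂`, if the maps into the corner `X₂ ⊗ Y₂` are injective then the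
two remaining maps are simultaneously injective. -/
lemma rTensor_injective_iff_lTensor_injective
    {X₁ X₂ Y₁ Y₂ : Type*} [AddCommGroup X₁] [Module R X₁] [AddCommGroup X₂] [Module R X₂]
    [AddCommGroup Y₁] [Module R Y₁] [AddCommGroup Y₂] [Module R Y₂]
    [Module.Flat R X₂] [Module.Flat R Y₂] {f : X₁ →ₗ[R] X₂} {g : Y₁ →ₗ[R] Y₂}
    (hf : Function.Injective f) (hg : Function.Injective g) :
    Function.Injective (f.rTensor Y₁) ↔ Function.Injective (g.lTensor X₁) := by
  have h₁ : Function.Injective (f.rTensor Y₂) :=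
    Module.Flat.rTensor_preserves_injective_linearMap f hf
  have h₂ : Function.Injective (g.lTensor X₂) :=
    Module.Flat.lTensor_preserves_injective_linearMap g hg
  rw [← h₁.of_comp_iff, ← h₂.of_comp_iff, ← LinearMap.coe_comp, ← LinearMap.coe_comp,
    LinearMap.lTensor_comp_rTensor, LinearMap.rTensor_comp_lTensor]

lemma torVanishes_one_iff_rTensor {K P : Type u} [AddCommGroup K] [Module R K] [AddCommGroup P]
    [Module R P] [Module.Flat R P] {f : K →ₗ[R] P} {g : P →ₗ[R] A} (hf : Function.Injective f)
    (hfg : Function.Exact f g) (hg : Function.Surjective g) :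
    TorVanishes R 1 A B ↔ Function.Injective (f.rTensor B) := by
  have hc := freeCover_surjective R B
  have he := exact_syzygyInclusion_freeCover R B
  rw [torVanishes_one_iff_syzygy]
  refine ⟨fun h => ?_, fun h => ?_⟩
  · rw [← LinearMap.lTensor_inj_iff_rTensor_inj]
    exact lTensor_injective_of_exact_of_exact_of_rTensor_injective he hc hfg hg
      ((LinearMap.lTensor_inj_iff_rTensor_inj _ _).1 h)
      (Module.Flat.lTensor_preserves_injective_linearMap _ hf)
  · exact lTensor_injective_of_exact_of_exact_of_rTensor_injective hfg hg he hc h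
      (Module.Flat.lTensor_preserves_injective_linearMap _ (syzygyInclusion_injective R _))

lemma torVanishes_add_two_iff_left {K P : Type u} [AddCommGroup K] [Module R K] [AddCommGroup P]
    [Module R P] [Module.Flat R P] {f : K →ₗ[R] P} {g : P →ₗ[R] A} (hf : Function.Injective f)
    (hfg : Function.Exact f g) (hg : Function.Surjective g) (n : ℕ) :
    TorVanishes R (n + 2) A B ↔ TorVanishes R (n + 1) K B := by
  induction n generalizing B with
  | zero =>
    rw [torVanishes_add_two_iff_syzygy, torVanishes_one_iff_rTensor hf hfg hg,
      torVanishes_one_iff_syzygy]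
    exact rTensor_injective_iff_lTensor_injective hf (syzygyInclusion_injective R B)
  | succ n ih =>
    exact (torVanishes_add_two_iff_syzygy (n + 1)).trans
      (ih.trans (torVanishes_add_two_iff_syzygy n).symm)

lemma torVanishes_of_shortExact {A₁ A₂ A₃ : Type u} [AddCommGroup A₁] [Module R A₁]
    [AddCommGroup A₂] [Module R A₂] [AddCommGroup A₃] [Module R A₃]
    {f : A₁ →ₗ[R] A₂} {g : A₂ →ₗ[R] A₃} (hf : Function.Injective f)
    (hfg : Function.Exact f g) (hg : Function.Surjective g) {n : ℕ}
    (h₂ : TorVanishes R (n + 2) A₂ B) (h₁ : TorVanishes R (n + 1) A₁ B) :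
    TorVanishes R (n + 2) A₃ B := by
  induction n generalizing B with
  | zero =>
    rw [torVanishes_add_two_iff_syzygy] at h₂ ⊢
    rw [torVanishes_one_iff_syzygy] at h₁
    have hc' := freeCover_surjective R (Syzygy R B)
    have he' := exact_syzygyInclusion_freeCover R (Syzygy R B)
    rw [torVanishes_one_iff_syzygy] at h₂ ⊢
    refine lTensor_injective_of_exact_of_exact_of_rTensor_injective hfg hg he' hc' ?_ h₂
    refine Function.Injective.of_comp
      (f := (syzygyInclusion R B).lTensor A₂) ?_
    rw [← LinearMap.coe_comp, LinearMap.lTensor_comp_rTensor, ← LinearMap.rTensor_comp_lTensor]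
    exact (Module.Flat.rTensor_preserves_injective_linearMap f hf).comp h₁
  | succ n ih =>
    rw [torVanishes_add_two_iff_syzygy] at h₁ h₂ ⊢
    exact ih h₂ h₁

variable (A B) in
lemma torVanishes_of_flat [Module.Flat R A] (n : ℕ) : TorVanishes R (n + 1) A B := by
  induction n generalizing B with
  | zero =>
    exact torVanishes_one_iff_syzygy.2
      (Module.Flat.lTensor_preserves_injective_linearMap _ (syzygyInclusion_injective R B))
  | succ n ih =>
    exact (torVanishes_add_two_iff_syzygy n).2 (ih _)

lemma TorVanishes.tensor_of_flat (F : Type u) [AddCommGroup F] [Module R F] [Module.Flat R F]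
    {n : ℕ} (h : TorVanishes R (n + 1) A B) : TorVanishes R (n + 1) (F ⊗[R] A) B := by
  induction n generalizing B with
  | zero =>
    rw [torVanishes_one_iff_syzygy] at h ⊢
    rw [LinearMap.lTensor_tensor]
    simpa using Module.Flat.lTensor_preserves_injective_linearMap (M := F) _ h
  | succ n ih =>
    rw [torVanishes_add_two_iff_syzygy] at h ⊢
    exact ih h

lemma hasProjectiveDimensionLT_of_exact [Module.Projective R P] (hf : Function.Injective f)
    (hfg : Function.Exact f g) (hg : Function.Surjective g) {n : ℕ}
    (h : HasProjectiveDimensionLT (ModuleCat.of R B) (n + 2)) :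
    HasProjectiveDimensionLT (ModuleCat.of R K) (n + 1) :=
  ((shortExact_of_linearMap hf hfg hg).hasProjectiveDimensionLT_X₃_iff n
    ((IsProjective.iff_projective _).1 ‹_›)).1 h

lemma projective_of_hasProjectiveDimensionLT_one
    (h : HasProjectiveDimensionLT (ModuleCat.of R A) 1) : Module.Projective R A :=
  (IsProjective.iff_projective A).2 (projective_iff_hasProjectiveDimensionLT_one.2 h)

lemma torVanishes_of_hasProjectiveDimensionLT {n : ℕ}
    (h : HasProjectiveDimensionLT (ModuleCat.of R A) (n + 1)) {i : ℕ} (hi : n ≤ i) :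
    TorVanishes R (i + 1) A B := by
  induction n generalizing A i with
  | zero =>
    have := projective_of_hasProjectiveDimensionLT_one h
    exact torVanishes_of_flat A B i
  | succ n ih =>
    have hc := freeCover_surjective R A
    obtain ⟨i, rfl⟩ : ∃ j, i = j + 1 := ⟨i - 1, by omega⟩
    exact (torVanishes_add_two_iff_left (syzygyInclusion_injective R A)
      (exact_syzygyInclusion_freeCover R A) hc i).2
      (ih (hasProjectiveDimensionLT_of_exact (syzygyInclusion_injective R A)
        (exact_syzygyInclusion_freeCover R A) hc h) (Nat.le_of_succ_le_succ hi))

/-- If `A` has finite projective dimension and is Tor-independent of `Z`, then eventual vanishing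
of `Tor(Z, B)` implies eventual vanishing of `Tor(A ⊗ Z, B)`. -/
lemma TorVanishes.tensor_of_hasProjectiveDimensionLT {Z : Type u} [AddCommGroup Z] [Module R Z]
    {n N : ℕ} (h : HasProjectiveDimensionLT (ModuleCat.of R A) (n + 1))
    (hA : ∀ i, TorVanishes R (i + 1) A Z) (hZ : ∀ i, N ≤ i → TorVanishes R (i + 1) Z B) {i : ℕ}
    (hi : N + n ≤ i) : TorVanishes R (i + 1) (A ⊗[R] Z) B := by
  induction n generalizing A i with
  | zero =>
    have := projective_of_hasProjectiveDimensionLT_one h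
    exact (hZ i hi).tensor_of_flat A
  | succ n ih =>
    have hc := freeCover_surjective R A
    have he := exact_syzygyInclusion_freeCover R A
    have hk := syzygyInclusion_injective R A
    obtain ⟨i, rfl⟩ : ∃ j, i = j + 1 := ⟨i - 1, by omega⟩
    exact torVanishes_of_shortExact ((torVanishes_one_iff_rTensor hk he hc).1 (hA 0))
      (rTensor_exact Z he hc) (LinearMap.rTensor_surjective Z hc)
      ((hZ (i + 1) (by omega)).tensor_of_flat _)
      (ih (hasProjectiveDimensionLT_of_exact hk he hc h)
        (fun i => (torVanishes_add_two_iff_left hk he hc i).1 (hA (i + 1))) (by omega))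

end Tor

section BaseChange

variable {R : Type u} [CommRing R] {S : Type u} [CommRing S] [Algebra R S]

lemma lTensor_baseChange_injective_iff {A K P : Type*} [AddCommGroup A] [Module R A] [Module S A]
    [IsScalarTower R S A] [AddCommGroup K] [Module R K] [AddCommGroup P] [Module R P]
    (f : K →ₗ[R] P) :
    Function.Injective ((f.baseChange S).lTensor A) ↔ Function.Injective (f.lTensor A) := by
  have h : ⇑(f.lTensor A) ∘ AlgebraTensorModule.cancelBaseChange R S S A K =
      AlgebraTensorModule.cancelBaseChange R S S A P ∘ ((f.baseChange S).lTensor A) :=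
    congr_arg DFunLike.coe (AlgebraTensorModule.lTensor_comp_cancelBaseChange (M := A) R S S f)
  rw [← EquivLike.comp_injective _ (AlgebraTensorModule.cancelBaseChange R S S A P), ← h,
    EquivLike.injective_comp]

lemma TorVanishes.baseChange_syzygyInclusion_injective {Z : Type u} [AddCommGroup Z] [Module R Z]
    (hZ : TorVanishes R 1 S Z) : Function.Injective ((syzygyInclusion R Z).baseChange S) :=
  torVanishes_one_iff_syzygy.1 hZ

variable (R S) in
lemma exact_baseChange_syzygyInclusion_freeCover (Z : Type u) [AddCommGroup Z] [Module R Z] :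
    Function.Exact ((syzygyInclusion R Z).baseChange S) ((freeCover R Z).baseChange S) :=
  lTensor_exact S (exact_syzygyInclusion_freeCover R Z) (freeCover_surjective R Z)

variable (R S) in
lemma baseChange_freeCover_surjective (Z : Type u) [AddCommGroup Z] [Module R Z] :
    Function.Surjective ((freeCover R Z).baseChange S) :=
  LinearMap.lTensor_surjective S (freeCover_surjective R Z)

/-- If `Z` is Tor-independent of `S`, then `Tor^R(A, Z)` and `Tor^S(A, S ⊗ Z)` vanish in the same
positive degrees for every `S`-module `A`. -/
lemma torVanishes_baseChange_iff {A Z : Type u} [AddCommGroup A] [Module R A] [Module S A]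
    [IsScalarTower R S A] [AddCommGroup Z] [Module R Z]
    (hZ : ∀ i, TorVanishes R (i + 1) S Z) (n : ℕ) :
    TorVanishes S (n + 1) A (S ⊗[R] Z) ↔ TorVanishes R (n + 1) A Z := by
  induction n generalizing Z with
  | zero =>
    rw [zero_add, torVanishes_one_iff (hZ 0).baseChange_syzygyInclusion_injective
      (exact_baseChange_syzygyInclusion_freeCover R S Z) (baseChange_freeCover_surjective R S Z),
      torVanishes_one_iff_syzygy, lTensor_baseChange_injective_iff]
  | succ n ih =>
    rw [torVanishes_add_two_iff (hZ 0).baseChange_syzygyInclusion_injective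
      (exact_baseChange_syzygyInclusion_freeCover R S Z) (baseChange_freeCover_surjective R S Z),
      torVanishes_add_two_iff_syzygy]
    exact ih fun i => (torVanishes_add_two_iff_syzygy i).1 (hZ (i + 1))

end BaseChange

section FiniteProjectiveDimension

variable {R : Type u} [CommRing R]

lemma HasFiniteProjDim.exists_hasProjectiveDimensionLT {X : ModuleCat.{u} R}
    (h : HasFiniteProjDim R X) : ∃ n : ℕ, HasProjectiveDimensionLT X (n + 1) := by
  obtain ⟨n, P, hP⟩ := h
  refine ⟨n, HasProjectiveDimensionLT.mk fun i hi Y e => ?_⟩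
  obtain ⟨f, hf, rfl⟩ := P.extMk_surjective e (i + 1) rfl
  obtain rfl : f = 0 := (hP i hi).eq_of_src _ _
  exact P.extMk_zero _ rfl

lemma hasFiniteProjDim_of_projective (M : Type u) [AddCommGroup M] [Module R M]
    [Module.Projective R M] : HasFiniteProjDim R (ModuleCat.of R M) := by
  have : Projective (ModuleCat.of R M) := (IsProjective.iff_projective _).1 ‹_›
  refine ⟨0, ProjectiveResolution.self _, fun i hi => ?_⟩
  exact HomologicalComplex.isZero_single_obj_X (ComplexShape.down ℕ) 0 (ModuleCat.of R M) i hi.ne'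

lemma HasFiniteProjDim.of_exact {K P M : Type u} [AddCommGroup K] [Module R K] [AddCommGroup P]
    [Module R P] [Module.Projective R P] [AddCommGroup M] [Module R M] {f : K →ₗ[R] P}
    {g : P →ₗ[R] M} (hf : Function.Injective f) (hfg : Function.Exact f g)
    (hg : Function.Surjective g) (h : HasFiniteProjDim R (ModuleCat.of R K)) :
    HasFiniteProjDim R (ModuleCat.of R M) := by
  obtain ⟨n, Q, hQ⟩ := h
  refine ⟨n + 1, spliceOfLinearMap hf hfg hg Q, fun i hi => ?_⟩
  obtain ⟨i, rfl⟩ : ∃ j, i = j + 1 := ⟨i - 1, by omega⟩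
  exact hQ i (by omega)

variable [IsNoetherianRing R]

lemma exists_finite_free_cover (M : Type u) [AddCommGroup M] [Module R M] [Module.Finite R M] :
    ∃ (K P : Type u) (_ : AddCommGroup K) (_ : Module R K) (_ : AddCommGroup P) (_ : Module R P)
      (f : K →ₗ[R] P) (g : P →ₗ[R] M), Module.Finite R K ∧ Module.Finite R P ∧
      Module.Free R P ∧ Function.Injective f ∧ Function.Exact f g ∧ Function.Surjective g := by
  obtain ⟨n, g, hg⟩ := Module.Finite.exists_fin' R M
  exact ⟨LinearMap.ker g, Fin n → R, inferInstance, inferInstance, inferInstance, inferInstance,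
    (LinearMap.ker g).subtype, g, inferInstance, inferInstance, inferInstance,
    Submodule.subtype_injective _, g.exact_subtype_ker_map, hg⟩

variable [IsLocalRing R]

lemma free_of_torVanishes_residueField {M : Type u} [AddCommGroup M] [Module R M]
    [Module.Finite R M] (h : TorVanishes R 1 (IsLocalRing.ResidueField R) M) :
    Module.Free R M := by
  obtain ⟨K, P, _, _, _, _, f, g, _, _, _, hf, hfg, hg⟩ := exists_finite_free_cover (R := R) M
  exact Module.free_of_lTensor_residueField_injective f g hg hfg
    ((torVanishes_one_iff hf hfg hg).1 h)

/-- Descent of finite projective dimension along a Tor-independent change of rings through which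
the residue field factors. -/
lemma hasFiniteProjDim_of_baseChange {S : Type u} [CommRing S] [Algebra R S]
    [Module S (IsLocalRing.ResidueField R)] [IsScalarTower R S (IsLocalRing.ResidueField R)]
    {n : ℕ} {Z : Type u} [AddCommGroup Z] [Module R Z] [Module.Finite R Z]
    (hZ : ∀ i, TorVanishes R (i + 1) S Z)
    (h : HasProjectiveDimensionLT (ModuleCat.of S (S ⊗[R] Z)) (n + 1)) :
    HasFiniteProjDim R (ModuleCat.of R Z) := by
  induction n generalizing Z with
  | zero =>
    have := projective_of_hasProjectiveDimensionLT_one h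
    have hk : TorVanishes S 1 (IsLocalRing.ResidueField R) (S ⊗[R] Z) :=
      (torVanishes_one_iff (f := (0 : PUnit.{u + 1} →ₗ[S] S ⊗[R] Z)) (g := LinearMap.id)
        (Function.injective_of_subsingleton _)
        (fun _ => ⟨fun h => ⟨0, h.symm⟩, fun ⟨_, h⟩ => h.symm⟩)
        Function.surjective_id).2 (Function.injective_of_subsingleton _)
    have := free_of_torVanishes_residueField ((torVanishes_baseChange_iff hZ 0).1 hk)
    exact hasFiniteProjDim_of_projective Z
  | succ n ih =>
    obtain ⟨K, P, _, _, _, _, f, g, _, _, _, hf, hfg, hg⟩ := exists_finite_free_cover (R := R) Z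
    refine .of_exact hf hfg hg
      (ih (fun i => (torVanishes_add_two_iff hf hfg hg i).1 (hZ (i + 1))) ?_)
    exact hasProjectiveDimensionLT_of_exact (f := f.baseChange S) (g := g.baseChange S)
      ((torVanishes_one_iff hf hfg hg).1 (hZ 0)) (lTensor_exact S hfg hg)
      (LinearMap.lTensor_surjective S hg) h

/-- Tor-persistence ascends along a change of rings of finite projective dimension through which
the residue field factors. -/
lemma TorPersistent.of_baseChange {S : Type u} [CommRing S] [Algebra R S]
    [Module S (IsLocalRing.ResidueField R)] [IsScalarTower R S (IsLocalRing.ResidueField R)]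
    {n : ℕ} (hS : HasProjectiveDimensionLT (ModuleCat.of R S) (n + 1)) (hTP : TorPersistent S) :
    TorPersistent R := by
  suffices H : ∀ (m : ℕ) (M : Type u) [AddCommGroup M] [Module R M] [Module.Finite R M],
      (∃ N, ∀ i, N ≤ i → TorVanishes R (i + 1) M M) →
      (∀ i, m ≤ i → TorVanishes R (i + 1) S M) → HasFiniteProjDim R (ModuleCat.of R M) by
    rintro M _ ⟨N, hN⟩
    exact H n M ⟨N, fun i hi => hN (i + 1) (by omega)⟩
      fun i hi => torVanishes_of_hasProjectiveDimensionLT hS hi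
  intro m
  induction m with
  | zero =>
    rintro M _ _ _ ⟨N, hN⟩ hM
    replace hM : ∀ i, TorVanishes R (i + 1) S M := fun i => hM i i.zero_le
    obtain ⟨d, hd⟩ := (hTP (ModuleCat.of S (S ⊗[R] M)) inferInstance
      ⟨N + n + 1, fun i hi => by
        obtain ⟨i, rfl⟩ : ∃ j, i = j + 1 := ⟨i - 1, by omega⟩
        exact (torVanishes_baseChange_iff hM i).2
          (TorVanishes.tensor_of_hasProjectiveDimensionLT hS hM hN
            (by omega))⟩).exists_hasProjectiveDimensionLT
    exact hasFiniteProjDim_of_baseChange hM hd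
  | succ m ih =>
    rintro M _ _ _ ⟨N, hN⟩ hM
    obtain ⟨K, P, _, _, _, _, f, g, _, _, _, hf, hfg, hg⟩ := exists_finite_free_cover (R := R) M
    refine .of_exact hf hfg hg (ih K ⟨N + 1, fun i hi => ?_⟩ fun i hi =>
      (torVanishes_add_two_iff hf hfg hg i).1 (hM (i + 1) (by omega)))
    exact (torVanishes_add_two_iff_left hf hfg hg i).1
      ((torVanishes_add_two_iff hf hfg hg (i + 1)).1 (hN (i + 2) (by omega)))

end FiniteProjectiveDimension

/-- Let `(R,𝔪,k)` be a commutative noetherian local ring and `x₁, …, xₙ` an `R`-regular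
sequence. If `R/(x₁, …, xₙ)` is Tor-persistent, then `R` is Tor-persistent. -/
theorem torPersistent_of_quotient_regular_sequence
    {R : Type u} [CommRing R] [IsNoetherianRing R] [IsLocalRing R]
    (xs : List R) (hreg : RingTheory.Sequence.IsRegular R xs)
    (hTP : TorPersistent (R ⧸ Ideal.ofList xs)) :
    TorPersistent R := by
  have hle : Ideal.ofList xs ≤ IsLocalRing.maximalIdeal R :=
    IsLocalRing.le_maximalIdeal (by simpa using hreg.2.symm)
  let φ : R ⧸ Ideal.ofList xs →+* IsLocalRing.ResidueField R := Ideal.Quotient.factor hle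
  let := φ.toAlgebra
  have : IsScalarTower R (R ⧸ Ideal.ofList xs) (IsLocalRing.ResidueField R) :=
    .of_algebraMap_eq' rfl
  refine .of_baseChange (S := R ⧸ Ideal.ofList xs) (n := xs.length) ?_ hTP
  have h := ModuleCat.projectiveDimension_quotient_eq_length xs hreg
  rw [ModuleCat.projectiveDimension_eq_of_linearEquiv (N := ModuleCat.of R (R ⧸ Ideal.ofList xs))
    (Shrink.linearEquiv.{u} R (R ⧸ Ideal.ofList xs))] at h
  exact (projectiveDimension_le_iff _ _).1 h.le
end

section
/- Let (R, m, k) be a commutative noetherian local ring and let x_1, …, x_n be an R-regular sequence such that x_i ∉ m² + (x_1, …, x_{i-1}) for every i = 1, …, n. If R is Tor-persistent, then the quotient ring R/(x_1, …, x_n) is Tor-persistent. -/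
open CategoryTheory CategoryTheory.Limits

universe u

namespace CharacterModule

variable {R : Type*} [CommRing R]

lemma exact_iff_exact_dual {A B C : Type*} [AddCommGroup A] [AddCommGroup B] [AddCommGroup C]
    [Module R A] [Module R B] [Module R C] {f : A →ₗ[R] B} {g : B →ₗ[R] C} (hgf : g ∘ₗ f = 0) :
    Function.Exact f g ↔ Function.Exact (dual g) (dual f) := by
  constructor
  · intro h χ
    constructor
    · intro hχ
      have hker : ∀ b ∈ LinearMap.ker g, χ b = 0 := by
        intro b hb
        obtain ⟨a, rfl⟩ := (h b).1 hb
        exact DFunLike.congr_fun hχ a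
      let χ₁ : CharacterModule (B ⧸ LinearMap.ker g) :=
        QuotientAddGroup.lift (LinearMap.ker g).toAddSubgroup χ hker
      let g₁ : (B ⧸ LinearMap.ker g) →ₗ[R] C := (LinearMap.ker g).liftQ g le_rfl
      have hg₁ : Function.Injective g₁ := by
        rw [← LinearMap.ker_eq_bot]
        exact Submodule.ker_liftQ_eq_bot _ _ _ le_rfl
      obtain ⟨ψ, hψ⟩ := dual_surjective_of_injective g₁ hg₁ χ₁
      exact ⟨ψ, DFunLike.ext _ _ fun b => DFunLike.congr_fun hψ (Submodule.Quotient.mk b)⟩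
    · rintro ⟨ψ, rfl⟩
      refine DFunLike.ext _ _ fun a => ?_
      have : g (f a) = 0 := DFunLike.congr_fun hgf a
      change ψ (g (f a)) = 0
      rw [this, map_zero]
  · intro h b
    constructor
    · intro hb
      change b ∈ LinearMap.range f
      rw [← Submodule.Quotient.mk_eq_zero]
      refine eq_zero_of_character_apply fun c => ?_
      have h1 : dual f (dual (LinearMap.range f).mkQ c) = 0 := by
        refine DFunLike.ext _ _ fun a => ?_
        have : (LinearMap.range f).mkQ (f a) = 0 := by simp
        change c ((LinearMap.range f).mkQ (f a)) = 0
        rw [this, map_zero]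
      obtain ⟨ψ, hψ⟩ := (h _).1 h1
      have := DFunLike.congr_fun hψ b
      refine this.symm.trans ?_
      change ψ (g b) = 0
      rw [hb, map_zero]
    · rintro ⟨a, rfl⟩
      exact DFunLike.congr_fun hgf a

lemma exact_rTensor_iff {M A B C : Type*} [AddCommGroup A] [AddCommGroup B] [AddCommGroup C]
    [AddCommGroup M] [Module R M]
    [Module R A] [Module R B] [Module R C] {f : A →ₗ[R] B} {g : B →ₗ[R] C} (hgf : g ∘ₗ f = 0) :
    Function.Exact (f.rTensor M) (g.rTensor M) ↔
      ∀ φ : B →ₗ[R] CharacterModule M, φ ∘ₗ f = 0 → ∃ ψ : C →ₗ[R] CharacterModule M, ψ ∘ₗ g = φ := by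
  rw [exact_iff_exact_dual (by rw [← LinearMap.rTensor_comp, hgf, LinearMap.rTensor_zero])]
  constructor
  · intro h φ hφ
    obtain ⟨χ, hχ⟩ := (h (homEquiv φ)).1 <| homEquiv.symm.injective <| by
      rw [map_zero, ← hφ]; rfl
    refine ⟨homEquiv.symm χ, homEquiv.injective ?_⟩
    rw [← hχ]
    exact homEquiv.symm.injective (by rw [LinearEquiv.symm_apply_apply]; rfl)
  · intro h χ
    constructor
    · intro hχ
      obtain ⟨ψ, hψ⟩ := h (homEquiv.symm χ) (by
        change homEquiv.symm (dual (f.rTensor M) χ) = 0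
        rw [hχ, map_zero])
      refine ⟨homEquiv ψ, homEquiv.symm.injective ?_⟩
      rw [← hψ]
      change _ = (g.lcomp R _) ψ
      rw [← dual_rTensor_conj_homEquiv]
      rfl
    · rintro ⟨χ, rfl⟩
      rw [← LinearMap.comp_apply, ← dual_comp, ← LinearMap.rTensor_comp, hgf,
        LinearMap.rTensor_zero, dual_zero, LinearMap.zero_apply]

end CharacterModule

section TorExt

open MonoidalCategory Abelian

variable {R : Type u} [CommRing R]

lemma CategoryTheory.ProjectiveResolution.subsingleton_ext_succ_iff
    {N : ModuleCat.{u} R} (P : ProjectiveResolution N) (A : ModuleCat.{u} R) (n : ℕ) :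
    Subsingleton (Ext N A (n + 1)) ↔
      ∀ φ : P.complex.X (n + 1) ⟶ A, P.complex.d (n + 2) (n + 1) ≫ φ = 0 →
        ∃ ψ : P.complex.X n ⟶ A, P.complex.d (n + 1) n ≫ ψ = φ := by
  constructor
  · intro h φ hφ
    exact (P.extMk_eq_zero_iff φ (n + 2) rfl hφ n rfl).1 (Subsingleton.elim _ _)
  · intro h
    refine subsingleton_of_forall_eq 0 fun α => ?_
    obtain ⟨f, hf, rfl⟩ := P.extMk_surjective α (n + 2) rfl
    exact (P.extMk_eq_zero_iff f (n + 2) rfl hf n rfl).2 (h f hf)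

lemma ModuleCat.subsingleton_tor_succ_iff (M N : ModuleCat.{u} R) (n : ℕ) :
    Subsingleton (((Tor (ModuleCat.{u} R) (n + 1)).obj M).obj N) ↔
      Subsingleton (Ext N (ModuleCat.of R (CharacterModule M)) (n + 1)) := by
  let P := ProjectiveResolution.of N
  rw [P.subsingleton_ext_succ_iff, ← ModuleCat.isZero_iff_subsingleton,
    Tor_obj, (P.isoLeftDerivedObj ((tensoringLeft _).obj M) (n + 1)).isZero_iff]
  have hd : (P.complex.d (n + 1) n).hom ∘ₗ (P.complex.d (n + 2) (n + 1)).hom = 0 := by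
    rw [← ModuleCat.hom_comp, P.complex.d_comp_d, ModuleCat.hom_zero]
  have key := CharacterModule.exact_rTensor_iff (M := M) hd
  trans Function.Exact ((P.complex.d (n + 2) (n + 1)).hom.lTensor M)
    ((P.complex.d (n + 1) n).hom.lTensor M)
  · change IsZero (HomologicalComplex.homology _ _) ↔ _
    rw [← HomologicalComplex.exactAt_iff_isZero_homology,
      HomologicalComplex.exactAt_iff' _ (n + 2) (n + 1) n (by simp) (by simp),
      ShortComplex.ShortExact.moduleCat_exact_iff_function_exact]
    rfl
  · rw [← LinearMap.rTensor_exact_iff_lTensor_exact, key]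
    constructor
    · intro h φ hφ
      obtain ⟨ψ, hψ⟩ := h φ.hom (by rw [← ModuleCat.hom_comp, hφ, ModuleCat.hom_zero])
      exact ⟨ModuleCat.ofHom ψ, ModuleCat.hom_ext hψ⟩
    · intro h φ hφ
      obtain ⟨ψ, hψ⟩ := h (ModuleCat.ofHom φ) (ModuleCat.hom_ext hφ)
      exact ⟨ψ.hom, congrArg ModuleCat.Hom.hom hψ⟩

end TorExt

namespace CategoryTheory.ShortComplex.ShortExact

variable {C : Type*} [Category* C] [Abelian C] {S : ShortComplex C}

lemma augment_exactAt_succ (hS : S.ShortExact) (K : ChainComplex C ℕ) (ε : K.X 0 ⟶ S.X₁)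
    (w : K.d 1 0 ≫ ε = 0) (w' : K.d 1 0 ≫ ε ≫ S.f = 0) (h₀ : (ShortComplex.mk _ _ w).Exact)
    (h : ∀ n, (ShortComplex.mk _ _ (K.d_comp_d (n + 2) (n + 1) n)).Exact) (n : ℕ) :
    (K.augment (ε ≫ S.f) w').ExactAt (n + 1) := by
  rw [HomologicalComplex.exactAt_iff' _ (n + 1 + 1) (n + 1) n (by simp) (by simp)]
  cases n with
  | zero =>
    have := hS.mono_f
    let α : ShortComplex.mk _ _ w ⟶ ShortComplex.mk (K.d 1 0) (ε ≫ S.f) w' :=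
      { τ₁ := 𝟙 _
        τ₂ := 𝟙 _
        τ₃ := S.f }
    have : Epi α.τ₁ := inferInstanceAs (Epi (𝟙 _))
    have : IsIso α.τ₂ := inferInstanceAs (IsIso (𝟙 _))
    have : Mono α.τ₃ := hS.mono_f
    exact (ShortComplex.exact_iff_of_epi_of_isIso_of_mono α).1 h₀
  | succ n => exact h n

/-- Splicing a projective resolution of the kernel onto a projective presentation. -/
noncomputable def augmentResolution (hS : S.ShortExact) [Projective S.X₂]
    (K : ChainComplex C ℕ) [∀ n, Projective (K.X n)] (ε : K.X 0 ⟶ S.X₁) [Epi ε]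
    (w : K.d 1 0 ≫ ε = 0) (w' : K.d 1 0 ≫ ε ≫ S.f = 0) (h₀ : (ShortComplex.mk _ _ w).Exact)
    (h : ∀ n, (ShortComplex.mk _ _ (K.d_comp_d (n + 2) (n + 1) n)).Exact) :
    ProjectiveResolution S.X₃ where
  complex := K.augment (ε ≫ S.f) w'
  projective n := by
    cases n with
    | zero => exact ‹Projective S.X₂›
    | succ n => exact inferInstanceAs (Projective (K.X n))
  π := (ChainComplex.toSingle₀Equiv _ _).symm
    ⟨S.g, show (ε ≫ S.f) ≫ S.g = 0 by rw [Category.assoc, S.zero, comp_zero]⟩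
  quasiIso := ⟨fun n => by
    cases n
    · rw [ChainComplex.quasiIsoAt₀_iff, ShortComplex.quasiIso_iff_of_zeros']
      · let α : ShortComplex.mk (ε ≫ S.f) S.g (by simp) ⟶ S :=
          { τ₁ := ε
            τ₂ := 𝟙 _
            τ₃ := 𝟙 _ }
        have : Epi α.τ₁ := ‹Epi ε›
        have : IsIso α.τ₂ := inferInstanceAs (IsIso (𝟙 _))
        have : Mono α.τ₃ := inferInstanceAs (Mono (𝟙 _))
        have key : (ShortComplex.mk (ε ≫ S.f) S.g (by simp)).Exact ∧ Epi S.g :=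
          ⟨(ShortComplex.exact_iff_of_epi_of_isIso_of_mono α).2 hS.exact, hS.epi_g⟩
        refine (ShortComplex.exact_and_epi_g_iff_of_iso ?_).2 key
        exact ShortComplex.isoMk (Iso.refl _) (Iso.refl _) (Iso.refl _)
          ((Category.id_comp _).trans (Category.comp_id _).symm)
          ((Category.id_comp _).trans
            ((ChainComplex.toSingle₀Equiv_symm_apply_f_zero (C := K.augment (ε ≫ S.f) w') S.g
              (show (ε ≫ S.f) ≫ S.g = 0 by rw [Category.assoc, S.zero, comp_zero])).symm.trans
              (Category.comp_id _).symm))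
      all_goals rfl
    · rw [quasiIsoAt_iff_exactAt']
      · exact hS.augment_exactAt_succ K ε w w' h₀ h _
      · apply ChainComplex.exactAt_succ_single_obj⟩

end CategoryTheory.ShortComplex.ShortExact

section FiniteProjDim

open Abelian

variable {R : Type u} [CommRing R]

lemma exists_projectiveResolution_of_hasProjectiveDimensionLT (n : ℕ) (M : ModuleCat.{u} R)
    [HasProjectiveDimensionLT M (n + 1)] :
    ∃ P : ProjectiveResolution M, ∀ i, n < i → IsZero (P.complex.X i) := by
  induction n generalizing M with
  | zero =>
    have : Projective M := by
      rwa [projective_iff_hasProjectiveDimensionLT_one]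
    refine ⟨ProjectiveResolution.self M, fun i hi => ?_⟩
    exact HomologicalComplex.isZero_single_obj_X _ _ _ _ hi.ne'
  | succ n ih =>
    have hS := M.shortExact_projectiveShortComplex
    have : HasProjectiveDimensionLT M.projectiveShortComplex.X₁ (n + 1) :=
      (hS.hasProjectiveDimensionLT_X₃_iff n inferInstance).1 ‹_›
    obtain ⟨Q, hQ⟩ := ih M.projectiveShortComplex.X₁
    obtain ⟨ε, _, w, h₀⟩ : ∃ (ε : Q.complex.X 0 ⟶ M.projectiveShortComplex.X₁) (_ : Epi ε)
        (w : Q.complex.d 1 0 ≫ ε = 0), (ShortComplex.mk _ _ w).Exact :=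
      ⟨Q.π.f 0, inferInstanceAs (Epi (Q.π.f 0)), Q.complex_d_comp_π_f_zero, Q.exact₀⟩
    refine ⟨hS.augmentResolution Q.complex ε w (by rw [reassoc_of% w, zero_comp]) h₀
      Q.exact_succ, fun i hi => ?_⟩
    obtain _ | i := i
    · omega
    · exact hQ i (by omega)

lemma hasFiniteProjDim_iff (M : ModuleCat.{u} R) :
    HasFiniteProjDim R M ↔ ∃ n, HasProjectiveDimensionLT M n := by
  constructor
  · rintro ⟨n, P, hP⟩
    refine ⟨n + 1, (hasProjectiveDimensionLT_iff M (n + 1)).2 fun i hi Y e => ?_⟩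
    obtain ⟨i, rfl⟩ := Nat.exists_eq_succ_of_ne_zero (show i ≠ 0 by omega)
    have := (P.subsingleton_ext_succ_iff Y i).2 fun φ _ => ⟨0, (hP _ (by omega)).eq_of_src _ _⟩
    exact Subsingleton.elim _ _
  · rintro ⟨n, hn⟩
    have : HasProjectiveDimensionLT M (n + 1) :=
      hasProjectiveDimensionLT_of_ge M n (n + 1) n.le_succ
    obtain ⟨P, hP⟩ := exists_projectiveResolution_of_hasProjectiveDimensionLT n M
    exact ⟨n, P, hP⟩

/-- Tor-persistence in terms of `Ext` into the character module. -/
lemma torPersistent_iff : TorPersistent R ↔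
    ∀ M : ModuleCat.{u} R, Module.Finite R M →
      (∃ n : ℕ, ∀ i, n ≤ i → Subsingleton (Ext M (ModuleCat.of R (CharacterModule M)) (i + 1))) →
      ∃ n, HasProjectiveDimensionLT M n := by
  refine forall₂_congr fun M _ => ?_
  rw [hasFiniteProjDim_iff]
  refine imp_congr ⟨?_, ?_⟩ Iff.rfl
  · rintro ⟨n, h⟩
    exact ⟨n, fun i hi => (ModuleCat.subsingleton_tor_succ_iff M M i).1 (h _ (by omega))⟩
  · rintro ⟨n, h⟩
    refine ⟨n + 1, fun i hi => ?_⟩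
    obtain ⟨i, rfl⟩ := Nat.exists_eq_succ_of_ne_zero (show i ≠ 0 by omega)
    exact (ModuleCat.subsingleton_tor_succ_iff M M i).2 (h i (by omega))

end FiniteProjDim

namespace CategoryTheory.ShortComplex.ShortExact

open Abelian

variable {C : Type*} [Category* C] [Abelian C] [HasExt C] {S : ShortComplex C}

lemma subsingleton_ext_X₂ (hS : S.ShortExact) (Y : C) {n : ℕ}
    (h₁ : Subsingleton (Ext S.X₁ Y n)) (h₃ : Subsingleton (Ext S.X₃ Y n)) :
    Subsingleton (Ext S.X₂ Y n) := by
  refine subsingleton_of_forall_eq 0 fun α => ?_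
  obtain ⟨β, rfl⟩ := Ext.contravariant_sequence_exact₂ hS Y α (Subsingleton.elim _ _)
  rw [Subsingleton.elim β 0, Ext.comp_zero]

lemma subsingleton_ext_X₁ (hS : S.ShortExact) (Y : C) {n : ℕ}
    (h₂ : Subsingleton (Ext S.X₂ Y n)) (h₃ : Subsingleton (Ext S.X₃ Y (n + 1))) :
    Subsingleton (Ext S.X₁ Y n) := by
  refine subsingleton_of_forall_eq 0 fun α => ?_
  obtain ⟨β, rfl⟩ := Ext.contravariant_sequence_exact₁ hS Y α (add_comm 1 n)
    (Subsingleton.elim _ _)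
  rw [Subsingleton.elim β 0, Ext.comp_zero]

lemma subsingleton_ext_X₃ (hS : S.ShortExact) (Y : C) {n : ℕ}
    (h₁ : Subsingleton (Ext S.X₁ Y n)) (h₂ : Subsingleton (Ext S.X₂ Y (n + 1))) :
    Subsingleton (Ext S.X₃ Y (n + 1)) := by
  refine subsingleton_of_forall_eq 0 fun α => ?_
  obtain ⟨β, rfl⟩ := Ext.contravariant_sequence_exact₃ hS Y α (Subsingleton.elim _ _)
    (add_comm 1 n)
  rw [Subsingleton.elim β 0, Ext.comp_zero]

lemma subsingleton_ext_X₃_succ_iff (hS : S.ShortExact) (Y : C) [Projective S.X₂] (n : ℕ) :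
    Subsingleton (Ext S.X₃ Y (n + 2)) ↔ Subsingleton (Ext S.X₁ Y (n + 1)) :=
  ⟨fun h => hS.subsingleton_ext_X₁ Y (Ext.subsingleton_of_projective _ _ _) h,
    fun h => hS.subsingleton_ext_X₃ Y h (Ext.subsingleton_of_projective _ _ _)⟩

lemma subsingleton_ext_X₃_one_iff (hS : S.ShortExact) (Y : C) [Projective S.X₂] :
    Subsingleton (Ext S.X₃ Y 1) ↔ ∀ φ : S.X₁ ⟶ Y, ∃ ψ : S.X₂ ⟶ Y, S.f ≫ ψ = φ := by
  constructor
  · intro h φ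
    obtain ⟨β, hβ⟩ := Ext.contravariant_sequence_exact₁ hS Y (Ext.mk₀ φ) (add_comm 1 0)
      (Subsingleton.elim _ _)
    obtain ⟨ψ, rfl⟩ := (Ext.mk₀_bijective _ _).2 β
    exact ⟨ψ, (Ext.mk₀_bijective _ _).1 (by rw [← hβ, Ext.mk₀_comp_mk₀])⟩
  · intro h
    refine subsingleton_of_forall_eq 0 fun α => ?_
    have := Ext.subsingleton_of_projective S.X₂ Y 0
    obtain ⟨β, rfl⟩ := Ext.contravariant_sequence_exact₃ hS Y α (Subsingleton.elim _ _)
      (add_comm 1 0)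
    obtain ⟨φ, rfl⟩ := (Ext.mk₀_bijective _ _).2 β
    obtain ⟨ψ, rfl⟩ := h φ
    rw [← Ext.mk₀_comp_mk₀, hS.extClass_comp_assoc]

end CategoryTheory.ShortComplex.ShortExact

section BaseChange

open TensorProduct Abelian Function

variable {R S : Type u} [CommRing R] [CommRing S] [Algebra R S] {x : R}

lemma LinearMap.shortExact_moduleCatMk {X₁ X₂ X₃ : Type u} [AddCommGroup X₁] [AddCommGroup X₂]
    [AddCommGroup X₃] [Module R X₁] [Module R X₂] [Module R X₃] {f : X₁ →ₗ[R] X₂}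
    {g : X₂ →ₗ[R] X₃} (hf : Injective f) (hfg : Exact f g) (hg : Surjective g) :
    (ShortComplex.moduleCatMk f g hfg.linearMap_comp_eq_zero).ShortExact where
  exact := (ShortComplex.ShortExact.moduleCat_exact_iff_function_exact _).2 hfg
  mono_f := (ModuleCat.mono_iff_injective _).2 hf
  epi_g := (ModuleCat.epi_iff_surjective _).2 hg

lemma one_tmul_eq_zero_iff (hsurj : Surjective (algebraMap R S))
    (hker : RingHom.ker (algebraMap R S) = Ideal.span {x})
    {L : Type*} [AddCommGroup L] [Module R L] {l : L} :
    (1 : S) ⊗ₜ[R] l = 0 ↔ ∃ l', x • l' = l := by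
  have hexact : Exact (LinearMap.lsmul R R x) (Algebra.linearMap R S) := fun r => by
    change algebraMap R S r = 0 ↔ _
    rw [← RingHom.mem_ker, hker, Ideal.mem_span_singleton']
    simp [mul_comm]
  have := rTensor_exact L hexact hsurj ((1 : R) ⊗ₜ l)
  rw [LinearMap.rTensor_tmul, Algebra.linearMap_apply, map_one] at this
  rw [this]
  constructor
  · rintro ⟨t, ht⟩
    refine ⟨TensorProduct.lid R L t, ?_⟩
    have h : TensorProduct.lid R L ((LinearMap.lsmul R R x).rTensor L t) = l := by simp [ht]
    rw [← h]
    clear ht h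
    induction t with
    | zero => simp
    | tmul a b => simp [mul_smul]
    | add a b ha hb => rw [map_add, map_add, map_add, smul_add, ha, hb]
  · rintro ⟨l', rfl⟩
    exact ⟨1 ⊗ₜ l', by simp [TensorProduct.smul_tmul']⟩

lemma exists_one_tmul_eq (hsurj : Surjective (algebraMap R S))
    {L : Type*} [AddCommGroup L] [Module R L] (t : S ⊗[R] L) : ∃ l : L, 1 ⊗ₜ l = t := by
  induction t with
  | zero => exact ⟨0, by simp⟩
  | tmul a b =>
    obtain ⟨r, rfl⟩ := hsurj a
    exact ⟨r • b, by rw [← TensorProduct.smul_tmul, Algebra.smul_def, mul_one]⟩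
  | add a b ha hb =>
    obtain ⟨l, rfl⟩ := ha
    obtain ⟨l', rfl⟩ := hb
    exact ⟨l + l', TensorProduct.tmul_add _ _ _⟩

/-- The base change to `S` of the complex `0 → ker g → F → L → 0`. -/
noncomputable abbrev LinearMap.baseChangeShortComplexKer (S : Type u) [CommRing S] [Algebra R S]
    {F L : Type u} [AddCommGroup L] [Module R L] [AddCommGroup F] [Module R F] (g : F →ₗ[R] L) :
    ShortComplex (ModuleCat.{u} S) :=
  ShortComplex.moduleCatMk ((LinearMap.ker g).subtype.baseChange S) (g.baseChange S)
    (by rw [← LinearMap.baseChange_comp]; ext; simp)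

lemma LinearMap.shortExact_baseChangeShortComplexKer (hsurj : Surjective (algebraMap R S))
    (hker : RingHom.ker (algebraMap R S) = Ideal.span {x})
    {F L : Type u} [AddCommGroup L] [Module R L] [AddCommGroup F] [Module R F]
    {g : F →ₗ[R] L} (hg : Surjective g) (hL : IsSMulRegular L x) :
    (g.baseChangeShortComplexKer S).ShortExact := by
  refine LinearMap.shortExact_moduleCatMk ?_ (f := (LinearMap.ker g).subtype.baseChange S)
    (g := g.baseChange S) (lTensor_exact S g.exact_subtype_ker_map hg)
    (LinearMap.lTensor_surjective S hg)
  rw [injective_iff_map_eq_zero]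
  intro t ht
  obtain ⟨k, rfl⟩ := exists_one_tmul_eq hsurj t
  rw [LinearMap.baseChange_tmul, one_tmul_eq_zero_iff hsurj hker] at ht
  rw [one_tmul_eq_zero_iff hsurj hker]
  obtain ⟨f, hf⟩ := ht
  refine ⟨⟨f, hL ?_⟩, Subtype.ext hf⟩
  change x • g f = x • 0
  rw [← map_smul, hf, smul_zero]
  exact k.2

lemma subsingleton_ext_of_baseChange (hsurj : Surjective (algebraMap R S))
    (hker : RingHom.ker (algebraMap R S) = Ideal.span {x}) (hx : IsSMulRegular R x)
    {A : Type u} [AddCommGroup A] [Module R A] [Module S A] [IsScalarTower R S A] (i : ℕ)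
    {L : Type u} [AddCommGroup L] [Module R L] (hL : IsSMulRegular L x)
    (h : Subsingleton (Ext (ModuleCat.of S (S ⊗[R] L)) (ModuleCat.of S A) (i + 1))) :
    Subsingleton (Ext (ModuleCat.of R L) (ModuleCat.of R A) (i + 1)) := by
  induction i generalizing L with
  | zero =>
    let g : (L →₀ R) →ₗ[R] L := Finsupp.linearCombination R id
    have hg : Surjective g := Finsupp.linearCombination_id_surjective R L
    have hR := LinearMap.shortExact_shortComplexKer hg
    have hS := LinearMap.shortExact_baseChangeShortComplexKer hsurj hker hg hL
    have : Projective (g.baseChangeShortComplexKer S).X₂ :=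
      inferInstanceAs (Projective (ModuleCat.of S (S ⊗[R] (L →₀ R))))
    have : Projective (LinearMap.shortComplexKer g).X₂ :=
      inferInstanceAs (Projective (ModuleCat.of R (L →₀ R)))
    refine (hR.subsingleton_ext_X₃_one_iff _).2 fun φ => ?_
    obtain ⟨ψ, hψ⟩ := (hS.subsingleton_ext_X₃_one_iff _).1 h
      (ModuleCat.ofHom (φ.hom.liftBaseChange S))
    let ψ' : S ⊗[R] (L →₀ R) →ₗ[S] A := ψ.hom
    refine ⟨ModuleCat.ofHom (ψ'.restrictScalars R ∘ₗ TensorProduct.mk R S _ 1), ?_⟩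
    ext k
    exact (congrArg (fun χ => χ.hom ((1 : S) ⊗ₜ k)) hψ).trans (one_smul S (φ k))
  | succ i ih =>
    let g : (L →₀ R) →ₗ[R] L := Finsupp.linearCombination R id
    have hg : Surjective g := Finsupp.linearCombination_id_surjective R L
    have hR := LinearMap.shortExact_shortComplexKer hg
    have hS := LinearMap.shortExact_baseChangeShortComplexKer hsurj hker hg hL
    have : Projective (g.baseChangeShortComplexKer S).X₂ :=
      inferInstanceAs (Projective (ModuleCat.of S (S ⊗[R] (L →₀ R))))
    have : Projective (LinearMap.shortComplexKer g).X₂ :=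
      inferInstanceAs (Projective (ModuleCat.of R (L →₀ R)))
    refine (hR.subsingleton_ext_X₃_succ_iff _ i).2 (ih (hx.finsupp.submodule _ _) ?_)
    exact (hS.subsingleton_ext_X₃_succ_iff _ i).1 h

end BaseChange

section ChangeOfRings

open TensorProduct Abelian Function

variable {R S : Type u} [CommRing R] [CommRing S] [Algebra R S] {x : R}

lemma smul_eq_zero_of_ker_eq_span (hker : RingHom.ker (algebraMap R S) = Ideal.span {x})
    {M : Type*} [AddCommGroup M] [Module R M] [Module S M] [IsScalarTower R S M] (m : M) :
    x • m = 0 := by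
  have : algebraMap R S x = 0 := by
    rw [← RingHom.mem_ker, hker]
    exact Ideal.mem_span_singleton_self x
  rw [← algebraMap_smul S, this, zero_smul]

/-- If `S = R / (x)` and `g : F → M` is a surjection from an `x`-regular `R`-module onto an
`S`-module, then `M` embeds into `S ⊗ ker g` with cokernel the kernel of `S ⊗ F → M`. -/
lemma exists_exact_tensor_ker (hsurj : Surjective (algebraMap R S))
    (hker : RingHom.ker (algebraMap R S) = Ideal.span {x})
    {F M : Type u} [AddCommGroup F] [Module R F] (hF : IsSMulRegular F x)
    [AddCommGroup M] [Module R M] [Module S M] [IsScalarTower R S M]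
    {g : F →ₗ[R] M} (hg : Surjective g) :
    ∃ (j : M →ₗ[S] S ⊗[R] LinearMap.ker g)
      (p : S ⊗[R] LinearMap.ker g →ₗ[S] LinearMap.ker (g.liftBaseChange S)),
      Injective j ∧ Exact j p ∧ Surjective p := by
  let j₀ : F →ₗ[R] S ⊗[R] LinearMap.ker g :=
    TensorProduct.mk R S _ 1 ∘ₗ (LinearMap.lsmul R F x).codRestrict (LinearMap.ker g) fun f => by
      simp [smul_eq_zero_of_ker_eq_span hker]
  have hj₀ (f : F) : j₀ f = 0 ↔ g f = 0 := by
    change (1 : S) ⊗ₜ[R] (_ : LinearMap.ker g) = 0 ↔ _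
    rw [one_tmul_eq_zero_iff hsurj hker]
    constructor
    · rintro ⟨k, hk⟩
      rw [← hF (congrArg Subtype.val hk)]
      exact k.2
    · intro hf
      exact ⟨⟨f, hf⟩, rfl⟩
  let j₁ : M →ₗ[R] S ⊗[R] LinearMap.ker g :=
    (LinearMap.ker g).liftQ j₀ (fun f hf => (hj₀ f).2 hf) ∘ₗ
      (g.quotKerEquivOfSurjective hg).symm.toLinearMap
  have hj₁ (f : F) : j₁ (g f) = j₀ f := by
    have : (g.quotKerEquivOfSurjective hg).symm (g f) = Submodule.Quotient.mk f := by
      rw [LinearEquiv.symm_apply_eq]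
      rfl
    change (LinearMap.ker g).liftQ j₀ (fun f hf => (hj₀ f).2 hf)
      ((g.quotKerEquivOfSurjective hg).symm (g f)) = _
    rw [this]
    rfl
  let j : M →ₗ[S] S ⊗[R] LinearMap.ker g := LinearMap.extendScalarsOfSurjective hsurj j₁
  have hj (f : F) : j (g f) = j₀ f := hj₁ f
  let p : S ⊗[R] LinearMap.ker g →ₗ[S] LinearMap.ker (g.liftBaseChange S) :=
    ((LinearMap.ker g).subtype.baseChange S).codRestrict _ fun t => by
      obtain ⟨k, rfl⟩ := exists_one_tmul_eq hsurj t
      simp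
  have hp (k : LinearMap.ker g) : (p (1 ⊗ₜ k)).1 = 1 ⊗ₜ k.1 := rfl
  refine ⟨j, p, ?_, ?_, ?_⟩
  · rw [injective_iff_map_eq_zero]
    intro m hm
    obtain ⟨f, rfl⟩ := hg m
    rwa [hj, hj₀] at hm
  · intro t
    obtain ⟨k, rfl⟩ := exists_one_tmul_eq hsurj t
    rw [Subtype.ext_iff, hp, ZeroMemClass.coe_zero, one_tmul_eq_zero_iff hsurj hker]
    constructor
    · rintro ⟨f, hf⟩
      refine ⟨g f, ?_⟩
      rw [hj]
      exact congrArg (TensorProduct.mk R S _ 1) (Subtype.ext hf)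
    · rintro ⟨m, hm⟩
      obtain ⟨f, rfl⟩ := hg m
      have : (p (1 ⊗ₜ k)).1 = (p (j₀ f)).1 := by rw [← hm, hj]
      rw [hp] at this
      have h2 : (p (j₀ f)).1 = (1 : S) ⊗ₜ[R] (x • f) := rfl
      rw [h2, ← sub_eq_zero, ← TensorProduct.tmul_sub, one_tmul_eq_zero_iff hsurj hker] at this
      obtain ⟨f', hf'⟩ := this
      exact ⟨f' + f, by rw [smul_add, hf', sub_add_cancel]⟩
  · rintro ⟨t, ht⟩
    obtain ⟨f, rfl⟩ := exists_one_tmul_eq hsurj t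
    have hf : g f = 0 := by simpa using ht
    exact ⟨1 ⊗ₜ ⟨f, hf⟩, Subtype.ext (hp _)⟩

/-- Over `S = R / (x)` with `x` regular, two consecutive vanishing `Ext`s over `S` force
vanishing of `Ext` over `R`. -/
lemma subsingleton_ext_restrictScalars (hsurj : Surjective (algebraMap R S))
    (hker : RingHom.ker (algebraMap R S) = Ideal.span {x}) (hx : IsSMulRegular R x)
    {A M : Type u} [AddCommGroup A] [Module R A] [Module S A] [IsScalarTower R S A]
    [AddCommGroup M] [Module R M] [Module S M] [IsScalarTower R S M] (i : ℕ)
    (h₁ : Subsingleton (Ext (ModuleCat.of S M) (ModuleCat.of S A) (i + 1)))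
    (h₂ : Subsingleton (Ext (ModuleCat.of S M) (ModuleCat.of S A) (i + 2))) :
    Subsingleton (Ext (ModuleCat.of R M) (ModuleCat.of R A) (i + 2)) := by
  let g : (M →₀ R) →ₗ[R] M := Finsupp.linearCombination R id
  have hg : Surjective g := Finsupp.linearCombination_id_surjective R M
  have hR := LinearMap.shortExact_shortComplexKer hg
  have : Projective (LinearMap.shortComplexKer g).X₂ :=
    inferInstanceAs (Projective (ModuleCat.of R (M →₀ R)))
  refine (hR.subsingleton_ext_X₃_succ_iff _ i).2
    (subsingleton_ext_of_baseChange hsurj hker hx i (hx.finsupp.submodule _ _) ?_)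
  have hg' : Surjective (g.liftBaseChange S) := fun m => by
    obtain ⟨f, rfl⟩ := hg m
    exact ⟨1 ⊗ₜ f, by simp⟩
  have hS := LinearMap.shortExact_shortComplexKer hg'
  have : Projective (LinearMap.shortComplexKer (g.liftBaseChange S)).X₂ :=
    inferInstanceAs (Projective (ModuleCat.of S (S ⊗[R] (M →₀ R))))
  obtain ⟨j, p, hj, hjp, hp⟩ := exists_exact_tensor_ker hsurj hker hx.finsupp hg
  exact (LinearMap.shortExact_moduleCatMk hj hjp hp).subsingleton_ext_X₂ _ h₁
    ((hS.subsingleton_ext_X₃_succ_iff _ i).1 h₂)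

end ChangeOfRings

section Nagata

open TensorProduct Function IsLocalRing

variable {R S : Type u} [CommRing R] [CommRing S] [Algebra R S] {x : R}

lemma exact_smul_compLeft (hker : RingHom.ker (algebraMap R S) = Ideal.span {x}) (ι : Type*) :
    Exact (LinearMap.lsmul R (ι → R) x) ((Algebra.linearMap R S).compLeft ι) := fun f => by
  have h (r : R) : algebraMap R S r = 0 ↔ ∃ r', x * r' = r := by
    rw [← RingHom.mem_ker, hker, Ideal.mem_span_singleton]
    exact ⟨fun ⟨c, hc⟩ => ⟨c, hc.symm⟩, fun ⟨c, hc⟩ => ⟨c, hc.symm⟩⟩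
  constructor
  · intro hf
    choose f' hf' using fun i => (h (f i)).1 (congrFun hf i)
    exact ⟨f', funext hf'⟩
  · rintro ⟨f', rfl⟩
    exact funext fun i => (h _).2 ⟨f' i, rfl⟩

lemma hasProjectiveDimensionLT_two_pi (hsurj : Surjective (algebraMap R S))
    (hker : RingHom.ker (algebraMap R S) = Ideal.span {x}) (hx : IsSMulRegular R x)
    (n : ℕ) : HasProjectiveDimensionLT (ModuleCat.of R (Fin n → S)) 2 := by
  have hinj : Injective (LinearMap.lsmul R (Fin n → R) x) := fun f g hfg =>
    funext fun i => hx (congrFun hfg i)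
  have := LinearMap.shortExact_moduleCatMk hinj (exact_smul_compLeft hker (Fin n))
    (fun f => ⟨fun i => (hsurj (f i)).choose, funext fun i => (hsurj (f i)).choose_spec⟩)
  have hP : Projective (ModuleCat.of R (Fin n → R)) := inferInstance
  exact (this.hasProjectiveDimensionLT_X₃_iff 0 hP).2 (by
    change HasProjectiveDimensionLT (ModuleCat.of R (Fin n → R)) 1
    infer_instance)

lemma Finsupp.mem_of_mem_ideal_smul_top {ι : Type*} {I : Ideal R} {f : ι →₀ R}
    (hf : f ∈ I • (⊤ : Submodule R (ι →₀ R))) (i : ι) : f i ∈ I := by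
  have := Submodule.mem_map_of_mem (f := Finsupp.lapply i) hf
  rw [Submodule.map_smul''] at this
  simpa using Submodule.smul_mono (le_refl I) le_top this

lemma Finsupp.mem_ideal_smul_top {ι : Type*} {I : Ideal R} {f : ι →₀ R} (hf : ∀ i, f i ∈ I) :
    f ∈ I • (⊤ : Submodule R (ι →₀ R)) := by
  rw [← f.sum_single]
  refine Submodule.sum_mem _ fun i _ => ?_
  rw [← mul_one (f i), ← smul_eq_mul, ← Finsupp.smul_single]
  exact Submodule.smul_mem_smul (hf i) trivial

variable [IsLocalRing R]

lemma one_tmul_residueField_eq_zero_iff {M : Type*} [AddCommGroup M] [Module R M]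
    {m : M} : (1 : ResidueField R) ⊗ₜ[R] m = 0 ↔ m ∈ maximalIdeal R • (⊤ : Submodule R M) := by
  rw [← LinearMap.ker_tensorProductMk]
  exact Iff.rfl

lemma exists_smul_eq_of_projective (hx : x ∉ maximalIdeal R ^ 2) {ι N : Type*} [Finite ι]
    [AddCommGroup N] [Module R N] [Module.Finite R N] [Module.Projective R N]
    {j : N →ₗ[R] ι →₀ R} (hj : LinearMap.range j ≤ maximalIdeal R • ⊤)
    {φ : (ι →₀ R) →ₗ[R] N} (hjφ : ∀ f, j (φ f) = x • f) (hφj : ∀ n, φ (j n) = x • n) (n : N) :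
    ∃ f, x • f = j n := by
  have : Module.Free R N := Module.free_of_flat_of_isLocalRing (R := R)
  have hφ : Injective (φ.lTensor (ResidueField R)) := by
    rw [injective_iff_map_eq_zero]
    intro t ht
    obtain ⟨f, rfl⟩ := exists_one_tmul_eq (S := ResidueField R) residue_surjective t
    rw [LinearMap.lTensor_tmul, one_tmul_residueField_eq_zero_iff] at ht
    have h2 : x • f ∈ maximalIdeal R • (maximalIdeal R • (⊤ : Submodule R (ι →₀ R))) := by
      have := Submodule.mem_map_of_mem (f := j) ht
      rw [Submodule.map_smul'', Submodule.map_top, hjφ] at this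
      exact Submodule.smul_mono le_rfl hj this
    rw [← Submodule.smul_assoc, smul_eq_mul, ← sq] at h2
    refine one_tmul_residueField_eq_zero_iff.2 (Finsupp.mem_ideal_smul_top fun i => ?_)
    rw [mem_maximalIdeal, mem_nonunits_iff]
    intro hu
    have : x * f i ∈ maximalIdeal R ^ 2 := Finsupp.mem_of_mem_ideal_smul_top h2 i
    exact hx ((Ideal.mul_unit_mem_iff_mem _ hu).1 this)
  obtain ⟨ψ, hψ⟩ := (split_injective_iff_lTensor_residueField_injective φ).2 hφ
  refine ⟨ψ n, ?_⟩
  rw [← map_smul, ← hφj]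
  exact LinearMap.congr_fun hψ (j n)

lemma exists_smul_eq_of_mem [IsNoetherianRing R] (hx : x ∉ maximalIdeal R ^ 2) {ι : Type*}
    [Finite ι] (K : Submodule R (ι →₀ R)) [Module.Projective R K] (hK : K ≤ maximalIdeal R • ⊤)
    (hxK : ∀ f, x • f ∈ K) {f : ι →₀ R} (hf : f ∈ K) : ∃ f', x • f' = f := by
  obtain ⟨φ, hφ⟩ : ∃ φ : (ι →₀ R) →ₗ[R] K, ∀ f, (φ f : ι →₀ R) = x • f :=
    ⟨(LinearMap.lsmul R (ι →₀ R) x).codRestrict K hxK, fun _ => rfl⟩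
  have hj : LinearMap.range K.subtype ≤ maximalIdeal R • ⊤ := by rwa [Submodule.range_subtype]
  exact exists_smul_eq_of_projective hx (j := K.subtype) hj hφ
    (fun n => Subtype.ext (hφ n)) ⟨f, hf⟩

/-- Nagata: over `S = R / (x)` with `x ∉ 𝔪²`, a finite `S`-module of projective dimension at
most one over `R` is free. -/
lemma free_of_hasProjectiveDimensionLT_two [IsNoetherianRing R] (hsurj : Surjective (algebraMap R S))
    (hker : RingHom.ker (algebraMap R S) = Ideal.span {x}) (hx : x ∉ maximalIdeal R ^ 2)
    {M : Type u} [AddCommGroup M] [Module R M] [Module S M] [IsScalarTower R S M]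
    [Module.Finite R M] (hM : HasProjectiveDimensionLT (ModuleCat.of R M) 2) :
    Module.Free S M := by
  let b := Module.Free.chooseBasis (ResidueField R) (ResidueField R ⊗[R] M)
  choose v hv using fun i => exists_one_tmul_eq (S := ResidueField R) residue_surjective (b i)
  have hspan := span_eq_top_of_tmul_eq_basis v b hv
  let g := Finsupp.linearCombination R v
  have hg : Surjective g := by
    rw [← LinearMap.range_eq_top, Finsupp.range_linearCombination, hspan]
  have hR := LinearMap.shortExact_shortComplexKer hg
  have hP : Projective (LinearMap.shortComplexKer g).X₂ :=
    inferInstanceAs (Projective (ModuleCat.of R (_ →₀ R)))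
  have : Module.Projective R (LinearMap.ker g) := by
    refine (IsProjective.iff_projective (R := R) (LinearMap.ker g)).2 ?_
    rw [projective_iff_hasProjectiveDimensionLT_one]
    exact (hR.hasProjectiveDimensionLT_X₃_iff 0 hP).1 hM
  have hK : LinearMap.ker g ≤ maximalIdeal R • ⊤ := by
    intro f hf
    refine Finsupp.mem_ideal_smul_top fun i => ?_
    have h0 : Finsupp.linearCombination (ResidueField R) b
        (f.mapRange (residue R) (map_zero _)) = 0 := by
      have : (1 : ResidueField R) ⊗ₜ[R] g f = 0 := by rw [hf, TensorProduct.tmul_zero]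
      rw [← this, Finsupp.linearCombination_apply, Finsupp.linearCombination_apply,
        Finsupp.sum_mapRange_index (by simp), Finsupp.sum, Finsupp.sum, TensorProduct.tmul_sum]
      refine Finset.sum_congr rfl fun j _ => ?_
      rw [TensorProduct.tmul_smul, hv]
      rfl
    have := DFunLike.congr_fun ((linearIndependent_iff.1 b.linearIndependent) _ h0) i
    rw [Finsupp.mapRange_apply] at this
    exact (residue_eq_zero_iff _).1 this
  refine Module.Free.of_basis (Module.Basis.mk (v := v) ?_ ?_)
  · rw [linearIndependent_iff]
    intro s hs
    obtain ⟨f, rfl⟩ : ∃ f : _ →₀ R, f.mapRange (algebraMap R S) (map_zero _) = s :=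
      Finsupp.mapRange_surjective _ (map_zero _) hsurj s
    have hf : f ∈ LinearMap.ker g := by
      rw [LinearMap.mem_ker, ← hs, Finsupp.linearCombination_apply,
        Finsupp.linearCombination_apply, Finsupp.sum_mapRange_index (by simp)]
      simp
    obtain ⟨f', rfl⟩ := exists_smul_eq_of_mem hx (LinearMap.ker g) hK
      (fun f => by simp [smul_eq_zero_of_ker_eq_span hker]) hf
    ext i
    have h := smul_eq_zero_of_ker_eq_span hker (S := S) (algebraMap R S (f' i))
    simpa [Algebra.smul_def] using h
  · rw [← Submodule.restrictScalars_le (S := R), Submodule.restrictScalars_span _ _ hsurj, hspan]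
    simp

end Nagata

section OneStep

open Function IsLocalRing

variable {R S : Type u} [CommRing R] [CommRing S] [Algebra R S] {x : R}

/-- Nagata: if `x ∉ 𝔪²` is regular and `S = R / (x)`, then a finite `S`-module of projective
dimension at most `d + 1` over `R` has projective dimension at most `d` over `S`. -/
lemma hasProjectiveDimensionLT_of_restrictScalars [IsNoetherianRing R] [IsLocalRing R]
    (hsurj : Surjective (algebraMap R S)) (hker : RingHom.ker (algebraMap R S) = Ideal.span {x})
    (hx : IsSMulRegular R x) (hx' : x ∉ maximalIdeal R ^ 2) (d : ℕ)
    {M : Type u} [AddCommGroup M] [Module R M] [Module S M] [IsScalarTower R S M]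
    [Module.Finite S M] (hM : HasProjectiveDimensionLT (ModuleCat.of R M) (d + 2)) :
    HasProjectiveDimensionLT (ModuleCat.of S M) (d + 1) := by
  have : Module.Finite R S := Module.Finite.of_surjective (Algebra.linearMap R S) hsurj
  have : IsNoetherianRing S := isNoetherianRing_of_surjective R S (algebraMap R S) hsurj
  induction d generalizing M with
  | zero =>
    have : Module.Finite R M := Module.Finite.trans S M
    have := free_of_hasProjectiveDimensionLT_two hsurj hker hx' hM
    have : Projective (ModuleCat.of S M) := inferInstance
    exact projective_iff_hasProjectiveDimensionLT_one.1 this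
  | succ d ih =>
    obtain ⟨n, g, hg⟩ := Module.Finite.exists_fin' S M
    have hR := LinearMap.shortExact_moduleCatMk (f := ((LinearMap.ker g).subtype.restrictScalars R))
      (g := g.restrictScalars R) Subtype.val_injective g.exact_subtype_ker_map hg
    have hS := LinearMap.shortExact_moduleCatMk (f := (LinearMap.ker g).subtype)
      (g := g) Subtype.val_injective g.exact_subtype_ker_map hg
    have hP : Projective (ModuleCat.of S (Fin n → S)) := inferInstance
    refine (hS.hasProjectiveDimensionLT_X₃_iff d hP).2 (ih ?_)
    have h₂ := hasProjectiveDimensionLT_two_pi (S := S) hsurj hker hx n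
    refine hR.hasProjectiveDimensionLT_X₁ (d + 2) ?_ hM
    exact hasProjectiveDimensionLT_of_ge (ModuleCat.of R (Fin n → S)) 2 _ (by omega)

lemma TorPersistent.of_ker_eq_span [IsNoetherianRing R] [IsLocalRing R] (hR : TorPersistent R)
    (hsurj : Surjective (algebraMap R S)) (hker : RingHom.ker (algebraMap R S) = Ideal.span {x})
    (hx : IsSMulRegular R x) (hx' : x ∉ maximalIdeal R ^ 2) : TorPersistent S := by
  rw [torPersistent_iff] at hR ⊢
  rintro M _ ⟨n, hn⟩
  have : Module.Finite R S := Module.Finite.of_surjective (Algebra.linearMap R S) hsurj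
  let _ : Module R M := Module.compHom M (algebraMap R S)
  have : IsScalarTower R S M := IsScalarTower.of_algebraMap_smul fun _ _ => rfl
  have : IsScalarTower R S (CharacterModule M) := IsScalarTower.of_algebraMap_smul fun r f => by
    ext m
    simp [CharacterModule.smul_apply]
  obtain ⟨d, hd⟩ := hR (ModuleCat.of R M) (Module.Finite.trans S M) ⟨n + 1, fun i hi => by
    obtain ⟨i, rfl⟩ := Nat.exists_eq_add_of_le' (Nat.le_of_add_left_le hi)
    exact subsingleton_ext_restrictScalars hsurj hker hx i (hn i (by omega))
      (hn (i + 1) (by omega))⟩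
  exact ⟨d + 1, hasProjectiveDimensionLT_of_restrictScalars hsurj hker hx hx' d (M := M)
    (hasProjectiveDimensionLT_of_ge (ModuleCat.of R M) d _ (by omega))⟩

end OneStep

lemma TorPersistent.of_ringEquiv {R S : Type u} [CommRing R] [CommRing S] (hR : TorPersistent R)
    (e : R ≃+* S) : TorPersistent S := by
  rw [torPersistent_iff] at hR ⊢
  rintro M _ ⟨n, hn⟩
  let F := ModuleCat.restrictScalars.{u} e.toRingHom
  have hF (X Y : ModuleCat.{u} S) (i : ℕ) :=
    F.mapExt_bijective_of_preservesProjectiveObjects X Y i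
  have hchar : ModuleCat.of R (CharacterModule (F.obj M)) =
    F.obj (ModuleCat.of S (CharacterModule M)) := rfl
  have hfin : Module.Finite R (F.obj M) := by
    let _ : Algebra R S := e.toRingHom.toAlgebra
    let _ : Module R M := Module.compHom M e.toRingHom
    have : IsScalarTower R S M := IsScalarTower.of_algebraMap_smul fun _ _ => rfl
    have : Module.Finite R S := Module.Finite.of_surjective (Algebra.linearMap R S) e.surjective
    exact (Module.Finite.trans S M : Module.Finite R M)
  obtain ⟨d, hd⟩ := hR (F.obj M) hfin ⟨n, fun i hi => by
    have := hn i hi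
    rw [hchar]
    exact (hF _ _ _).2.subsingleton⟩
  refine ⟨d, (hasProjectiveDimensionLT_iff.{u} _ _).2 fun i hi Y α => ?_⟩
  have := HasProjectiveDimensionLT.subsingleton (F.obj M) d i hi (F.obj Y)
  exact (hF _ _ _).1 (Subsingleton.elim _ _)

section Quotient

open IsLocalRing

variable {R : Type u} [CommRing R]

lemma ofList_take_ofFn {n : ℕ} (x : Fin n → R) (i : Fin n) :
    Ideal.ofList ((List.ofFn x).take i) = Ideal.span (x '' {j | j < i}) := by
  refine congrArg Ideal.span (Set.ext fun r => ?_)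
  simp only [Set.mem_ofPred_eq, List.mem_take_iff_getElem, Set.mem_image]
  constructor
  · rintro ⟨k, hk, rfl⟩
    simp only [List.length_ofFn, lt_min_iff] at hk
    exact ⟨⟨k, hk.2⟩, hk.1, by simp⟩
  · rintro ⟨j, hj, rfl⟩
    exact ⟨j, by simpa using hj, by simp⟩

lemma TorPersistent.quotient_sup_span_singleton [IsNoetherianRing R] [IsLocalRing R] {I : Ideal R}
    (hI : TorPersistent (R ⧸ I)) {x : R} (hreg : IsSMulRegular (R ⧸ I) x)
    (hx : x ∉ maximalIdeal R ^ 2 + I) (hne : I ≠ ⊤) :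
    TorPersistent (R ⧸ I ⊔ Ideal.span {x}) := by
  have : Nontrivial (R ⧸ I) := Ideal.Quotient.nontrivial_iff.2 hne
  have : IsLocalRing (R ⧸ I) :=
    IsLocalRing.of_surjective' (Ideal.Quotient.mk I) Ideal.Quotient.mk_surjective
  let f := Ideal.Quotient.factor (le_sup_left : I ≤ I ⊔ Ideal.span {x})
  let _ : Algebra (R ⧸ I) (R ⧸ I ⊔ Ideal.span {x}) := f.toAlgebra
  refine hI.of_ker_eq_span (x := Ideal.Quotient.mk I x) (Ideal.Quotient.factor_surjective _) ?_ ?_ ?_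
  · change RingHom.ker f = _
    rw [Ideal.Quotient.factor_ker, Ideal.map_sup, Ideal.map_quotient_self, bot_sup_eq,
      Ideal.map_span, Set.image_singleton]
  · intro a b hab
    exact hreg hab
  · intro h
    rw [← map_maximalIdeal_of_surjective _ Ideal.Quotient.mk_surjective, ← Ideal.map_pow,
      ← Ideal.mem_comap,
      Ideal.comap_map_of_surjective _ Ideal.Quotient.mk_surjective] at h
    refine hx ?_
    rwa [← RingHom.ker_eq_comap_bot, Ideal.mk_ker] at h

end Quotient

/-- Let `(R,𝔪,k)` be a commutative noetherian local ring and `x₁, …, xₙ` an `R`-regular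
sequence with `xᵢ ∉ 𝔪² + (x₁, …, xᵢ₋₁)` for every `i`. If `R` is Tor-persistent, then
`R/(x₁, …, xₙ)` is Tor-persistent. -/
theorem torPersistent_quotient_of_torPersistent
    {R : Type u} [CommRing R] [IsNoetherianRing R] [IsLocalRing R]
    {n : ℕ} (x : Fin n → R)
    (hreg : RingTheory.Sequence.IsRegular R (List.ofFn x))
    (hx : ∀ i : Fin n,
      x i ∉ (IsLocalRing.maximalIdeal R) ^ 2 + Ideal.span (x '' {j | j < i}))
    (hTP : TorPersistent R) :
    TorPersistent (R ⧸ Ideal.span (Set.range x)) := by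
  have hne : Ideal.span (Set.range x) ≠ ⊤ := by
    intro h
    have h1 := hreg.top_ne_smul
    rw [smul_eq_mul, Ideal.mul_top] at h1
    refine h1 (h.symm.trans (congrArg Ideal.span (Set.ext fun r => ?_)))
    simp [List.mem_ofFn]
  suffices H : ∀ k ≤ n, TorPersistent (R ⧸ Ideal.span (x '' {j | (j : ℕ) < k})) by
    have := H n le_rfl
    rwa [show {j : Fin n | (j : ℕ) < n} = Set.univ by ext j; simp, Set.image_univ] at this
  intro k
  induction k with
  | zero =>
    intro _
    have : Ideal.span (x '' {j | (j : ℕ) < 0}) = ⊥ := by simp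
    rw [this]
    exact hTP.of_ringEquiv (RingEquiv.quotientBot R).symm
  | succ k ih =>
    intro hk
    have hset : x '' {j | (j : ℕ) < k + 1} = x '' {j | (j : ℕ) < k} ∪ {x ⟨k, hk⟩} := by
      rw [← Set.image_singleton, ← Set.image_union]
      congr 1
      ext j
      simp [Fin.ext_iff, le_iff_eq_or_lt]
    rw [hset, Ideal.span_union]
    refine (ih (by omega)).quotient_sup_span_singleton ?_ (hx ⟨k, hk⟩) fun h => hne ?_
    · have := hreg.regular_mod_prev k (by simpa using hk)
      have he := ofList_take_ofFn x ⟨k, hk⟩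
      rw [he, smul_eq_mul, Ideal.mul_top] at this
      rwa [List.getElem_ofFn] at this
    · exact top_le_iff.1 (h.symm.trans_le (Ideal.span_mono (Set.image_subset_range _ _)))
end
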